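/- arXiv:1410.3307 — 2 statements merged into one kernel-verified Lean document; each statement's English description precedes it below -/
import Mathlib

section
/- Let q ∈ [0,1) and θ > 0. Define q_0 = −θ ∑_{m=0}^∞ q^m/(1+m), and for j ≥ 1, q_j = θ · (1/(j(j+1))) · ∑_{m=0}^∞ ((j)_m / (2+j)_m) q^m. Define p : ℕ → ℝ by p_0 = e^{q_0} and p_n = (1/n) ∑_{k=0}^{n−1} (n−k) q_{n−k} p_k for n ≥ 1. Then lim_{n→∞} [ n³·(p_n − θ/((1−q)n²)) − (2θ²/(1−q)²)·log n ] = (θ²(2C_E − 3 + 2·log(1−q)) − θ(1+q)) / (1−q)², where C_E is the Euler–Mascheroni constant. -/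
open Filter Topology

/-- harmonic numbers, with the convention `0⁻¹ = 0` -/
noncomputable def hh (n : ℕ) : ℝ := ∑ k ∈ Finset.range (n+1), (k:ℝ)⁻¹

lemma hh_eq (n : ℕ) : hh n = (harmonic n : ℝ) := by
  unfold hh harmonic
  rw [Finset.sum_range_succ']
  push_cast
  simp

lemma hh_nonneg (n : ℕ) : 0 ≤ hh n := by unfold hh; positivity

lemma hh_mono {m n : ℕ} (h : m ≤ n) : hh m ≤ hh n := by
  unfold hh
  apply Finset.sum_le_sum_of_subset_of_nonneg
  · intro x; simp; omega
  · intros; positivity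

lemma one_le_hh {n : ℕ} (h : 1 ≤ n) : 1 ≤ hh n := by
  have := hh_mono h
  have h1 : hh 1 = 1 := by simp [hh, Finset.sum_range_succ]
  linarith

lemma hh_sub_log : Tendsto (fun n : ℕ => hh n - Real.log n) atTop (𝓝 Real.eulerMascheroniConstant) := by
  simp only [hh_eq]; exact Real.tendsto_harmonic_sub_log

lemma hh_sq_div : Tendsto (fun n : ℕ => hh n ^ 2 / n) atTop (𝓝 0) := by
  have hl : Tendsto (fun n : ℕ => Real.log n ^ 2 / (n:ℝ)) atTop (𝓝 0) := by
    have h := (Real.isLittleO_pow_log_id_atTop (n := 2)).tendsto_div_nhds_zero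
    exact h.comp tendsto_natCast_atTop_atTop
  have h1 : Tendsto (fun n : ℕ => (1:ℝ) / (n:ℝ)) atTop (𝓝 0) := tendsto_one_div_atTop_nhds_zero_nat
  have h2 := (h1.const_mul 2).add (hl.const_mul 2)
  simp only [mul_zero, add_zero] at h2
  refine squeeze_zero (fun n => by positivity) (fun n => ?_) h2
  have hb : hh n ≤ 1 + Real.log n := by rw [hh_eq]; exact harmonic_le_one_add_log n
  have h0 := hh_nonneg n
  rw [← mul_div_assoc, ← mul_div_assoc, ← add_div]
  gcongr
  nlinarith [sq_nonneg (1 - Real.log n)]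

lemma hh_div : Tendsto (fun n : ℕ => hh n / n) atTop (𝓝 0) := by
  refine squeeze_zero' (Eventually.of_forall fun n => div_nonneg (hh_nonneg n) (by positivity)) ?_ hh_sq_div
  filter_upwards [eventually_ge_atTop 1] with n hn
  gcongr
  nlinarith [one_le_hh hn]

lemma hh_reflect (n : ℕ) : ∑ k ∈ Finset.range (n+1), (((n-k : ℕ)):ℝ)⁻¹ = hh n := by
  unfold hh
  rw [← Finset.sum_range_reflect]
  apply Finset.sum_congr rfl
  intro k hk
  congr 2
  simp at hk; omega

lemma inv_conv (n : ℕ) (hn : 1 ≤ n) :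
    ∑ k ∈ Finset.range (n+1), (k:ℝ)⁻¹ * (((n-k : ℕ)):ℝ)⁻¹ ≤ 2 * (hh n / n) := by
  have : 2 * (hh n / n) = ∑ k ∈ Finset.range (n+1), ((k:ℝ)⁻¹ + (((n-k : ℕ)):ℝ)⁻¹) / n := by
    rw [← Finset.sum_div, Finset.sum_add_distrib, hh_reflect]
    change _ = (hh n + hh n) / _
    ring
  rw [this]
  apply Finset.sum_le_sum
  intro k hk
  have hk' : k ≤ n := by simp at hk; omega
  obtain ⟨j, rfl⟩ := Nat.exists_eq_add_of_le hk'
  simp only [Nat.add_sub_cancel_left]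
  rcases Nat.eq_zero_or_pos k with rfl | hk0
  · simp; positivity
  rcases Nat.eq_zero_or_pos j with rfl | hj0
  · simp; positivity
  have : (0:ℝ) < k := by exact_mod_cast hk0
  have : (0:ℝ) < j := by exact_mod_cast hj0
  apply le_of_eq
  push_cast
  field_simp
  ring

/-- convolution of sequences bounded by `1/n` tends to zero -/
lemma conv_small (a b : ℕ → ℝ) (c d : ℝ) (hc : 0 ≤ c) 
    (ha : ∀ n, |a n| ≤ c * (n:ℝ)⁻¹) (hb : ∀ n, |b n| ≤ d * (n:ℝ)⁻¹) (n : ℕ) (hn : 1 ≤ n) :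
    |∑ k ∈ Finset.range (n+1), a (n-k) * b k| ≤ c * d * (2 * (hh n / n)) := by
  have hd : 0 ≤ d := by have := (abs_nonneg _).trans (hb 1); simpa using this
  refine (Finset.abs_sum_le_sum_abs _ _).trans ?_
  refine le_trans ?_ (mul_le_mul_of_nonneg_left (inv_conv n hn) (by positivity))
  rw [Finset.mul_sum]
  apply Finset.sum_le_sum
  intro k _
  rw [abs_mul]
  calc _ ≤ (c * ((n-k:ℕ):ℝ)⁻¹) * (d * (k:ℝ)⁻¹) := mul_le_mul (ha _) (hb _) (abs_nonneg _) (by positivity)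
    _ = _ := by ring

lemma conv_dct (u b : ℕ → ℝ) (c α : ℝ) (hu : ∀ n, |u n| ≤ c) (hlim : Tendsto u atTop (𝓝 α))
    (hb : Summable (fun k => |b k|)) :
    Tendsto (fun n : ℕ => ∑ k ∈ Finset.range (n+1), u (n-k) * b k) atTop (𝓝 (α * ∑' k, b k)) := by
  have h := tendsto_tsum_of_dominated_convergence (𝓕 := atTop)
    (f := fun n k => if k ∈ Finset.range (n+1) then u (n-k) * b k else 0) (g := fun k => α * b k)
    (bound := fun k => c * |b k|) (hb.mul_left c) ?_ ?_
  · rw [tsum_mul_left] at h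
    refine h.congr (fun n => ?_)
    rw [tsum_eq_sum (s := Finset.range (n+1))]
    · apply Finset.sum_congr rfl
      intro k hk
      rw [if_pos hk]
    · intro k hk
      rw [if_neg hk]
  · intro k
    refine ((hlim.comp (tendsto_sub_atTop_nat k)).mul_const (b k)).congr' ?_
    filter_upwards [eventually_ge_atTop k] with n hn
    rw [if_pos (by simp; omega)]
    rfl
  · refine Eventually.of_forall fun n k => ?_
    have hc : 0 ≤ c := (abs_nonneg _).trans (hu 0)
    split_ifs
    · rw [Real.norm_eq_abs, abs_mul]
      gcongr
      exact hu _
    · simp; positivity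

lemma abs_le_of_sq {a c : ℝ} {n : ℕ} (hn : n ≠ 0 ∨ a = 0) (h : |(n:ℝ)^2 * a| ≤ c) : |(n:ℝ) * a| ≤ c * (n:ℝ)⁻¹ := by
  rcases Nat.eq_zero_or_pos n with rfl | h0
  · simp
  have : (0:ℝ) < n := by exact_mod_cast h0
  rw [← div_eq_mul_inv, le_div_iff₀ this]
  calc _ = |(n:ℝ)^2 * a| := by rw [abs_mul, abs_mul, abs_pow, abs_of_pos this]; ring
    _ ≤ c := h

lemma conv_sq (a b : ℕ → ℝ) (c d α β : ℝ)
    (ha : ∀ n:ℕ, |(n:ℝ)^2 * a n| ≤ c) (hb : ∀ n:ℕ, |(n:ℝ)^2 * b n| ≤ d)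
    (hal : Tendsto (fun n:ℕ => (n:ℝ)^2 * a n) atTop (𝓝 α))
    (hbl : Tendsto (fun n:ℕ => (n:ℝ)^2 * b n) atTop (𝓝 β))
    (hsa : Summable (fun k => |a k|)) (hsb : Summable (fun k => |b k|)) :
    Tendsto (fun n : ℕ => (n:ℝ)^2 * ∑ k ∈ Finset.range (n+1), a (n-k) * b k) atTop
      (𝓝 (α * ∑' k, b k + β * ∑' k, a k)) := by
  have h1 := conv_dct _ b c α ha hal hsb
  have h2 := conv_dct _ a d β hb hbl hsa
  have hc : 0 ≤ c := (abs_nonneg _).trans (ha 0)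
  have h3 : Tendsto (fun n : ℕ => ∑ k ∈ Finset.range (n+1), (((n-k:ℕ):ℝ) * a (n-k)) * ((k:ℝ) * b k)) atTop (𝓝 0) := by
    have hz : Tendsto (fun n : ℕ => c * d * (2 * (hh n / n))) atTop (𝓝 0) := by
      simpa using (hh_div.const_mul 2).const_mul (c*d)
    refine squeeze_zero_norm' ?_ hz
    filter_upwards [eventually_ge_atTop 1] with n hn
    refine conv_small (fun n => (n:ℝ) * a n) (fun n => (n:ℝ) * b n) c d hc ?_ ?_ n hn
    · intro n
      rcases Nat.eq_zero_or_pos n with rfl | h0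
      · simp
      exact abs_le_of_sq (Or.inl h0.ne') (ha n)
    · intro n
      rcases Nat.eq_zero_or_pos n with rfl | h0
      · simp
      exact abs_le_of_sq (Or.inl h0.ne') (hb n)
  have h := (h1.add h2).add (h3.const_mul 2)
  rw [mul_zero, add_zero] at h
  refine h.congr (fun n => ?_)
  rw [← Finset.sum_range_reflect (fun k => ((n-k:ℕ):ℝ)^2 * b (n-k) * a k), Finset.mul_sum, Finset.mul_sum,
    ← Finset.sum_add_distrib, ← Finset.sum_add_distrib]
  apply Finset.sum_congr rfl
  intro k hk
  have hk' : k ≤ n := by simp at hk; omega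
  obtain ⟨j, rfl⟩ := Nat.exists_eq_add_of_le hk'
  have e1 : k + j + 1 - 1 - k = j := by omega
  have e2 : k + j - j = k := by omega
  simp only [Nat.add_sub_cancel_left, e1, e2]
  push_cast
  ring

lemma tail_le (f : ℕ → ℝ) (T c : ℝ) (hf : HasSum f T) (n : ℕ)
    (h : ∀ k, n ≤ k → f k ≤ c * ((k:ℝ)⁻¹ - ((k:ℝ)+1)⁻¹)) :
    T - ∑ k ∈ Finset.range n, f k ≤ c * (n:ℝ)⁻¹ := by
  have ht := hf.tendsto_sum_nat
  have hz : Tendsto (fun m : ℕ => c * (m:ℝ)⁻¹) atTop (𝓝 0) := by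
    simpa using (tendsto_inv_atTop_nhds_zero_nat (𝕜 := ℝ)).const_mul c
  have hl := ht.add hz
  rw [add_zero] at hl
  have key : ∀ m, n ≤ m → ∑ k ∈ Finset.range m, f k + c * (m:ℝ)⁻¹ ≤ ∑ k ∈ Finset.range n, f k + c * (n:ℝ)⁻¹ := by
    intro m hm
    induction m, hm using Nat.le_induction with
    | base => exact le_rfl
    | succ m hm ih =>
      rw [Finset.sum_range_succ]
      have := h m hm
      push_cast
      linarith
  have := le_of_tendsto hl (by filter_upwards [eventually_ge_atTop n] with m hm using key m hm)
  linarith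

section

structure CoreHyp (A B D σ : ℝ) (p r s : ℕ → ℝ) : Prop where
  hA : 0 < A
  hp : ∀ n, 0 ≤ p n
  hp1 : HasSum p 1
  hrec : ∀ n : ℕ, (n:ℝ) * p n = ∑ k ∈ Finset.range (n+1), r (n-k) * p k
  hrs : ∀ n : ℕ, r n = A * (n:ℝ)⁻¹ + s n
  hs0 : s 0 = 0
  hr0 : ∀ n, 0 ≤ r n
  hrA : ∀ n : ℕ, r n ≤ A * (n:ℝ)⁻¹
  hs : ∀ n : ℕ, |(n:ℝ)^2 * s n| ≤ D
  hsl : Tendsto (fun n:ℕ => (n:ℝ)^2 * s n) atTop (𝓝 (-B))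
  hsσ : HasSum s σ

lemma frac_le {n k : ℕ} (h : k ≤ n) : (n:ℝ) * ((n-k:ℕ):ℝ)⁻¹ ≤ 1 + k * ((n-k:ℕ):ℝ)⁻¹ := by
  rcases h.eq_or_lt with rfl | h
  · simp
  have : (0:ℝ) < (n-k:ℕ) := by exact_mod_cast Nat.sub_pos_of_lt h
  have e : (n:ℝ) = (n-k:ℕ) + k := by push_cast [Nat.cast_sub h.le]; ring
  apply le_of_eq
  rw [e, add_mul, mul_inv_cancel₀ this.ne']

lemma frac_eq {n k : ℕ} (h : k < n) : (n:ℝ) * ((n-k:ℕ):ℝ)⁻¹ = 1 + k * ((n-k:ℕ):ℝ)⁻¹ := by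
  have : (0:ℝ) < (n-k:ℕ) := by exact_mod_cast Nat.sub_pos_of_lt h
  have e : (n:ℝ) = (n-k:ℕ) + k := by push_cast [Nat.cast_sub h.le]; ring
  rw [e, add_mul, mul_inv_cancel₀ this.ne']

variable {A B D σ : ℝ} {p r s : ℕ → ℝ}

lemma CoreHyp.sum_le (H : CoreHyp A B D σ p r s) (n : ℕ) : ∑ k ∈ Finset.range n, p k ≤ 1 :=
  sum_le_hasSum _ (fun i _ => H.hp i) H.hp1

lemma CoreHyp.recN (H : CoreHyp A B D σ p r s) (n : ℕ) :
    (n:ℝ) * p n = ∑ k ∈ Finset.range n, r (n-k) * p k := by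
  have h0 : r 0 = 0 := by rw [H.hrs, H.hs0]; simp
  rw [H.hrec, Finset.sum_range_succ, Nat.sub_self, h0]; simp

lemma CoreHyp.step1 (H : CoreHyp A B D σ p r s) (n : ℕ) :
    (n:ℝ)^2 * p n ≤ A + A * ∑ k ∈ Finset.range n, ((n-k:ℕ):ℝ)⁻¹ * (k * p k) := by
  have h1 : (n:ℝ)^2 * p n = ∑ k ∈ Finset.range n, n * (r (n-k) * p k) := by
    rw [← Finset.mul_sum, ← H.recN]; ring
  have h2 : ∑ k ∈ Finset.range n, n * (r (n-k) * p k) ≤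
      ∑ k ∈ Finset.range n, (A * p k + A * (((n-k:ℕ):ℝ)⁻¹ * (k * p k))) := by
    apply Finset.sum_le_sum
    intro k hk
    have hk' := Finset.mem_range.1 hk
    calc (n:ℝ) * (r (n-k) * p k) ≤ n * ((A * ((n-k:ℕ):ℝ)⁻¹) * p k) := by
            have := H.hrA (n-k); have := H.hp k; gcongr
      _ = A * ((n:ℝ) * ((n-k:ℕ):ℝ)⁻¹) * p k := by ring
      _ = _ := by rw [frac_eq hk']; ring
  rw [Finset.sum_add_distrib, ← h1, ← Finset.mul_sum, ← Finset.mul_sum] at h2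
  have := H.sum_le n
  have := mul_le_mul_of_nonneg_left this H.hA.le
  linarith

lemma convU (p : ℕ → ℝ) (C : ℝ) (n : ℕ) (hn : 1 ≤ n) (hC : 0 ≤ C)
    (h : ∀ k < n, (k:ℝ)^2 * p k ≤ C) :
    ∑ k ∈ Finset.range n, ((n-k:ℕ):ℝ)⁻¹ * (k * p k) ≤ C * (2 * (hh n / n)) := by
  refine le_trans ?_ (mul_le_mul_of_nonneg_left (inv_conv n hn) hC)
  rw [Finset.sum_range_succ, Nat.sub_self]
  simp only [Nat.cast_zero, inv_zero, mul_zero, add_zero]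
  rw [Finset.mul_sum]
  apply Finset.sum_le_sum
  intro k hk
  have hk' := h k (Finset.mem_range.1 hk)
  have : (k:ℝ) * p k ≤ C * (k:ℝ)⁻¹ := by
    rcases Nat.eq_zero_or_pos k with rfl | h0
    · simp
    have : (0:ℝ) < k := by exact_mod_cast h0
    rw [← div_eq_mul_inv, le_div_iff₀ this]
    linarith
  calc _ ≤ ((n-k:ℕ):ℝ)⁻¹ * (C * (k:ℝ)⁻¹) := by gcongr
    _ = _ := by ring

lemma CoreHyp.bound (H : CoreHyp A B D σ p r s) : ∃ C, 0 < C ∧ ∀ n : ℕ, (n:ℝ)^2 * p n ≤ C := by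
  have hA := H.hA
  have hz : ∀ᶠ n : ℕ in atTop, A * (2 * (hh n / n)) < 1/2 := by
    have : Tendsto (fun n : ℕ => A * (2 * (hh n / n))) atTop (𝓝 0) := by
      simpa using (hh_div.const_mul 2).const_mul A
    exact this.eventually_lt_const (by norm_num)
  obtain ⟨N, hN⟩ := eventually_atTop.1 hz
  refine ⟨2 * A + ∑ k ∈ Finset.range (N+1), (k:ℝ)^2 * p k, ?_, ?_⟩
  · have : 0 ≤ ∑ k ∈ Finset.range (N+1), (k:ℝ)^2 * p k :=
      Finset.sum_nonneg (fun i _ => mul_nonneg (by positivity) (H.hp i))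
    positivity
  set C := 2 * A + ∑ k ∈ Finset.range (N+1), (k:ℝ)^2 * p k with hC
  have hpos : 0 ≤ ∑ k ∈ Finset.range (N+1), (k:ℝ)^2 * p k :=
      Finset.sum_nonneg (fun i _ => mul_nonneg (by positivity) (H.hp i))
  have hC0 : 0 ≤ C := by positivity
  intro n
  induction n using Nat.strong_induction_on with
  | _ n ih =>
    by_cases hn : n ≤ N
    · have := Finset.single_le_sum (s := Finset.range (N+1)) (f := fun k : ℕ => (k:ℝ)^2 * p k)
        (fun i _ => mul_nonneg (by positivity) (H.hp i)) (Finset.mem_range.2 (show n < N+1 by omega))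
      linarith
    · have h1 := convU p C n (by omega) hC0 ih
      have h2 := H.step1 n
      have h3 := hN n (by omega)
      have h4 := mul_le_mul_of_nonneg_left h1 hA.le
      have h5 : A * (C * (2 * (hh n / n))) ≤ C * (1/2) := by
        calc _ = C * (A * (2 * (hh n / n))) := by ring
          _ ≤ _ := by gcongr
      linarith

lemma CoreHyp.tail (H : CoreHyp A B D σ p r s) : ∃ C, 0 < C ∧ ∀ n : ℕ, 1 ≤ n →
    1 - ∑ k ∈ Finset.range n, p k ≤ C * (n:ℝ)⁻¹ := by
  obtain ⟨C, hC, h⟩ := H.bound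
  refine ⟨2 * C, by positivity, fun n hn => tail_le p 1 (2*C) H.hp1 n ?_⟩
  intro k hk
  have : (1:ℝ) ≤ k := by exact_mod_cast hn.trans hk
  have h1 := h k
  have e : 2 * C * ((k:ℝ)⁻¹ - ((k:ℝ)+1)⁻¹) = 2 * C / (k * (k+1)) := by field_simp; ring
  rw [e, le_div_iff₀ (by positivity)]
  have := H.hp k
  nlinarith [mul_nonneg this (by positivity : (0:ℝ) ≤ (k:ℝ)), mul_nonneg (mul_nonneg this (by positivity : (0:ℝ) ≤ (k:ℝ))) (sub_nonneg.2 ‹(1:ℝ) ≤ k›)]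

/-- exact first expansion -/
lemma CoreHyp.exp1 (H : CoreHyp A B D σ p r s) (n : ℕ) :
    (n:ℝ)^2 * p n = A * ∑ k ∈ Finset.range n, p k + A * ∑ k ∈ Finset.range n, ((n-k:ℕ):ℝ)⁻¹ * (k * p k)
      + n * ∑ k ∈ Finset.range n, s (n-k) * p k := by
  have h1 : (n:ℝ)^2 * p n = ∑ k ∈ Finset.range n, n * (r (n-k) * p k) := by
    rw [← Finset.mul_sum, ← H.recN]; ring
  rw [h1, Finset.mul_sum, Finset.mul_sum, Finset.mul_sum, ← Finset.sum_add_distrib, ← Finset.sum_add_distrib]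
  apply Finset.sum_congr rfl
  intro k hk
  have := frac_eq (Finset.mem_range.1 hk)
  rw [H.hrs]
  linear_combination A * p k * this

lemma CoreHyp.exp2 (H : CoreHyp A B D σ p r s) (n : ℕ) :
    (n:ℝ)^3 * p n = A * n * ∑ k ∈ Finset.range n, p k + A * ∑ k ∈ Finset.range n, k * p k
      + A * ∑ k ∈ Finset.range n, ((n-k:ℕ):ℝ)⁻¹ * ((k:ℝ)^2 * p k)
      + n^2 * ∑ k ∈ Finset.range n, s (n-k) * p k := by
  have h1 : (n:ℝ)^3 * p n = n * ((n:ℝ)^2 * p n) := by ring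
  rw [h1, H.exp1, mul_add, mul_add, ← mul_assoc (n:ℝ) n, ← pow_two]
  congr 1
  have : (n:ℝ) * (A * ∑ k ∈ Finset.range n, ((n-k:ℕ):ℝ)⁻¹ * (k * p k)) = A * ∑ k ∈ Finset.range n, k * p k
      + A * ∑ k ∈ Finset.range n, ((n-k:ℕ):ℝ)⁻¹ * ((k:ℝ)^2 * p k) := by
    simp only [Finset.mul_sum]
    rw [← Finset.sum_add_distrib]
    apply Finset.sum_congr rfl
    intro k hk
    have := frac_eq (Finset.mem_range.1 hk)
    linear_combination A * k * p k * this
  rw [this]; ring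

lemma CoreHyp.rate (H : CoreHyp A B D σ p r s) : ∃ K, 0 ≤ K ∧ ∀ n : ℕ, 1 ≤ n →
    |(n:ℝ)^2 * p n - A| ≤ K * (hh n / n) := by
  obtain ⟨C, hC, hb⟩ := H.bound
  obtain ⟨C', hC', ht⟩ := H.tail
  have hA := H.hA
  have hD : 0 ≤ D := (abs_nonneg _).trans (H.hs 0)
  refine ⟨A * C' + A * (C * 2) + (D * (1 + C * 2) + D * (C * 2)), by positivity, fun n hn => ?_⟩
  have hn0 : (0:ℝ) < n := by exact_mod_cast hn
  have hh1 := one_le_hh hn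
  have hU := convU p C n hn hC.le (fun k _ => hb k)
  set U := ∑ k ∈ Finset.range n, ((n-k:ℕ):ℝ)⁻¹ * (k * p k) with hUd
  have hU0 : 0 ≤ U := Finset.sum_nonneg fun k _ => mul_nonneg (by positivity) (mul_nonneg (by positivity) (H.hp k))
  have hnV : n * ∑ k ∈ Finset.range n, ((n-k:ℕ):ℝ)⁻¹ * p k = ∑ k ∈ Finset.range n, p k + U := by
    rw [Finset.mul_sum, hUd, ← Finset.sum_add_distrib]
    apply Finset.sum_congr rfl
    intro k hk
    have := frac_eq (Finset.mem_range.1 hk)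
    linear_combination p k * this
  set V := ∑ k ∈ Finset.range n, ((n-k:ℕ):ℝ)⁻¹ * p k with hVd
  have hS : |n * ∑ k ∈ Finset.range n, s (n-k) * p k| ≤ D * V + D * U := by
    rw [Finset.mul_sum, hUd, hVd, Finset.mul_sum, Finset.mul_sum, ← Finset.sum_add_distrib]
    refine (Finset.abs_sum_le_sum_abs _ _).trans (Finset.sum_le_sum fun k hk => ?_)
    have hk' := Finset.mem_range.1 hk
    have hf := frac_eq hk'
    have hj : (1:ℝ) ≤ (n-k:ℕ) := by exact_mod_cast Nat.sub_pos_of_lt hk'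
    have hs := H.hs (n-k)
    have hpk := H.hp k
    set j : ℝ := ((n-k:ℕ):ℝ)
    have hs' : |s (n-k)| ≤ D * (j⁻¹ * j⁻¹) := by
      rw [abs_mul, abs_of_nonneg (by positivity)] at hs
      have : D * (j⁻¹ * j⁻¹) = D / j^2 := by field_simp
      rw [this, le_div_iff₀ (by positivity)]
      linarith
    rw [abs_mul, abs_mul, abs_of_pos hn0, abs_of_nonneg hpk]
    calc (n:ℝ) * (|s (n-k)| * p k) ≤ n * ((D * (j⁻¹ * j⁻¹)) * p k) := by gcongr
      _ = D * j⁻¹ * p k * (n * j⁻¹) := by ring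
      _ = D * (j⁻¹ * p k) + D * (j⁻¹ * (k * p k)) * j⁻¹ := by rw [hf]; ring
      _ ≤ D * (j⁻¹ * p k) + D * (j⁻¹ * (k * p k)) * 1 := by
          gcongr
          exact inv_le_one_of_one_le₀ hj
      _ = _ := by ring
  have hx : (n:ℝ)⁻¹ ≤ hh n / n := by rw [← one_div]; gcongr
  have hVb : V ≤ (1 + C * 2) * (hh n / n) := by
    have : V = (∑ k ∈ Finset.range n, p k) * (n:ℝ)⁻¹ + U * (n:ℝ)⁻¹ := by
      field_simp; linarith
    have h1 := H.sum_le n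
    have hi : (n:ℝ)⁻¹ ≤ 1 := inv_le_one_of_one_le₀ (by exact_mod_cast hn)
    have : V ≤ 1 * (n:ℝ)⁻¹ + U * 1 := by rw [this]; gcongr
    linarith
  have e := H.exp1 n
  have hts := ht n hn
  have h1 := H.sum_le n
  have e2 : (n:ℝ)^2 * p n - A = - (A * (1 - ∑ k ∈ Finset.range n, p k)) + A * U
      + n * ∑ k ∈ Finset.range n, s (n-k) * p k := by rw [e]; ring
  have hts' : C' * (n:ℝ)⁻¹ ≤ C' * (hh n / n) := by gcongr
  have a1 : 0 ≤ A * (1 - ∑ k ∈ Finset.range n, p k) := mul_nonneg hA.le (by linarith)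
  have a2 : A * (1 - ∑ k ∈ Finset.range n, p k) ≤ A * (C' * (hh n / n)) := by gcongr; linarith
  have a3 : 0 ≤ A * U := by positivity
  have a4 : A * U ≤ A * (C * (2 * (hh n / n))) := by gcongr
  have a5 : D * V ≤ D * ((1 + C * 2) * (hh n / n)) := by gcongr
  have a6 : D * U ≤ D * (C * (2 * (hh n / n))) := by gcongr
  have a7 := abs_le.1 hS
  rw [e2, abs_le]
  constructor <;> nlinarith

end

section
variable {A B D σ : ℝ} {p r s : ℕ → ℝ}

lemma CoreHyp.lim1 (H : CoreHyp A B D σ p r s) :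
    Tendsto (fun n : ℕ => (n:ℝ)^2 * p n) atTop (𝓝 A) := by
  obtain ⟨K, hK, h⟩ := H.rate
  rw [tendsto_iff_norm_sub_tendsto_zero]
  refine squeeze_zero' (Eventually.of_forall fun n => norm_nonneg _) ?_
    (by simpa using hh_div.const_mul K : Tendsto (fun n : ℕ => K * (hh n / n)) atTop (𝓝 0))
  filter_upwards [eventually_ge_atTop 1] with n hn using h n hn

lemma CoreHyp.limT (H : CoreHyp A B D σ p r s) :
    Tendsto (fun n : ℕ => (n:ℝ) * (1 - ∑ k ∈ Finset.range n, p k)) atTop (𝓝 A) := by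
  have h1 : Tendsto (fun n : ℕ => (n:ℝ)^2 * p n * (1 + (n:ℝ)⁻¹)) atTop (𝓝 A) := by
    simpa using H.lim1.mul ((tendsto_inv_atTop_nhds_zero_nat (𝕜 := ℝ)).const_add 1)
  rw [Metric.tendsto_atTop] at h1 ⊢
  intro ε hε
  obtain ⟨N, hN⟩ := h1 (ε/2) (by positivity)
  refine ⟨N+1, fun n hn => ?_⟩
  have hn0 : (0:ℝ) < n := by exact_mod_cast (show 0 < n by omega)
  have hk0 : ∀ k : ℕ, n ≤ k → (A - ε/2) * ((k:ℝ)⁻¹ - ((k:ℝ)+1)⁻¹) ≤ p k ∧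
      p k ≤ (A + ε/2) * ((k:ℝ)⁻¹ - ((k:ℝ)+1)⁻¹) := by
    intro k hk
    have hk0 : (0:ℝ) < k := by exact_mod_cast (show 0 < k by omega)
    have h := hN k (by omega)
    rw [Real.dist_eq, abs_lt] at h
    have e : (k:ℝ)^2 * p k * (1 + (k:ℝ)⁻¹) = (k * (k+1)) * p k := by field_simp
    have e2 : ((k:ℝ)⁻¹ - ((k:ℝ)+1)⁻¹) = 1 / (k * (k+1)) := by field_simp; ring
    rw [e] at h
    rw [e2, mul_one_div, mul_one_div, div_le_iff₀ (by positivity), le_div_iff₀ (by positivity)]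
    constructor <;> linarith
  have hu := tail_le p 1 (A + ε/2) H.hp1 n (fun k hk => (hk0 k hk).2)
  have hl := tail_le (fun k => - p k) (-1) (-(A - ε/2)) H.hp1.neg n
    (fun k hk => by have := (hk0 k hk).1; linarith)
  rw [Finset.sum_neg_distrib] at hl
  rw [← div_eq_mul_inv, le_div_iff₀ hn0] at hu hl
  rw [Real.dist_eq, abs_lt]
  constructor <;> nlinarith

lemma CoreHyp.lim2 (H : CoreHyp A B D σ p r s) :
    Tendsto (fun n : ℕ => ∑ k ∈ Finset.range n, (k:ℝ) * p k - A * Real.log n) atTop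
      (𝓝 (σ + A * Real.eulerMascheroniConstant)) := by
  obtain ⟨C, hC, ht⟩ := H.tail
  have hA := H.hA
  set T : ℕ → ℝ := fun m => if m = 0 then 0 else 1 - ∑ k ∈ Finset.range m, p k with hT
  have hTb : ∀ n, |T n| ≤ C * (n:ℝ)⁻¹ := by
    intro n
    by_cases h : n = 0
    · simp [hT, h]
    · have := H.sum_le n
      simp only [hT, h, if_false]
      rw [abs_of_nonneg (by linarith)]
      exact ht n (by omega)
  have hrb : ∀ n, |r n| ≤ A * (n:ℝ)⁻¹ := fun n => by
    rw [abs_of_nonneg (H.hr0 n)]; exact H.hrA n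
  have hz : Tendsto (fun n : ℕ => ∑ k ∈ Finset.range (n+1), T (n-k) * r k) atTop (𝓝 0) := by
    refine squeeze_zero_norm' ?_ (by simpa using (hh_div.const_mul 2).const_mul (C*A) :
      Tendsto (fun n : ℕ => C * A * (2 * (hh n / n))) atTop (𝓝 0))
    filter_upwards [eventually_ge_atTop 1] with n hn
    exact conv_small T r C A hC.le hTb hrb n hn
  have hsum := H.hsσ.tendsto_sum_nat
  have hi : Tendsto (fun n : ℕ => A * (n:ℝ)⁻¹) atTop (𝓝 0) := by
    simpa using (tendsto_inv_atTop_nhds_zero_nat (𝕜 := ℝ)).const_mul A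
  have h := ((hsum.add (hh_sub_log.const_mul A)).sub hi).sub hz
  simp only [sub_zero] at h
  refine h.congr (fun n => ?_)
  have e1 : ∑ k ∈ Finset.range n, (k:ℝ) * p k = ∑ j ∈ Finset.range n, r j * ∑ k ∈ Finset.range (n-j), p k := by
    simp only [Finset.mul_sum]
    rw [← Finset.sum_range_diag_flip n (fun j k => r j * p k)]
    apply Finset.sum_congr rfl
    intro m _
    rw [H.hrec, ← Finset.sum_range_reflect]
    apply Finset.sum_congr rfl
    intro k hk
    have hk' := Finset.mem_range.1 hk
    have e1 : m - (m + 1 - 1 - k) = k := by omega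
    have e2 : m + 1 - 1 - k = m - k := by omega
    rw [e1, e2]
  have e2 : ∑ k ∈ Finset.range (n+1), T (n-k) * r k = ∑ j ∈ Finset.range n, r j * (1 - ∑ k ∈ Finset.range (n-j), p k) := by
    rw [Finset.sum_range_succ]
    have : T (n-n) * r n = 0 := by simp [hT]
    rw [this, add_zero]
    apply Finset.sum_congr rfl
    intro k hk
    have hk' := Finset.mem_range.1 hk
    have : n - k ≠ 0 := by omega
    simp only [hT, this, if_false]
    ring
  have e3 : ∑ j ∈ Finset.range n, r j = A * (hh n - (n:ℝ)⁻¹) + ∑ j ∈ Finset.range n, s j := by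
    unfold hh
    rw [Finset.sum_range_succ, add_sub_cancel_right, Finset.mul_sum, ← Finset.sum_add_distrib]
    exact Finset.sum_congr rfl fun k _ => H.hrs k
  rw [e1, e2]
  simp only [mul_sub, mul_one, Finset.sum_sub_distrib]
  rw [e3]
  ring

lemma CoreHyp.lim3 (H : CoreHyp A B D σ p r s) :
    Tendsto (fun n : ℕ => ∑ k ∈ Finset.range n, ((n-k:ℕ):ℝ)⁻¹ * ((k:ℝ)^2 * p k) - A * Real.log n) atTop
      (𝓝 (A * Real.eulerMascheroniConstant)) := by
  obtain ⟨K, hK, hr⟩ := H.rate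
  have hA := H.hA
  have hz : Tendsto (fun n : ℕ => ∑ k ∈ Finset.range (n+1), ((n-k:ℕ):ℝ)⁻¹ * ((k:ℝ)^2 * p k - A)) atTop (𝓝 0) := by
    have hb : Tendsto (fun n : ℕ => K * (2 * (hh n ^ 2 / n)) + (n:ℝ)⁻¹ * A) atTop (𝓝 0) := by
      simpa using ((hh_sq_div.const_mul 2).const_mul K).add
        ((tendsto_inv_atTop_nhds_zero_nat (𝕜 := ℝ)).mul_const A)
    refine squeeze_zero_norm' ?_ hb
    filter_upwards [eventually_ge_atTop 1] with n hn
    refine (norm_sum_le _ _).trans ?_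
    have h1 : ∀ k ∈ Finset.range (n+1), ‖((n-k:ℕ):ℝ)⁻¹ * ((k:ℝ)^2 * p k - A)‖ ≤
        K * hh n * ((k:ℝ)⁻¹ * ((n-k:ℕ):ℝ)⁻¹) + (if k = 0 then (n:ℝ)⁻¹ * A else 0) := by
      intro k hk
      have hk' : k ≤ n := by have := Finset.mem_range.1 hk; omega
      by_cases h0 : k = 0
      · subst h0
        simp [abs_of_pos hA]
      · rw [if_neg h0, add_zero, norm_mul, Real.norm_eq_abs, Real.norm_eq_abs, abs_of_nonneg (by positivity)]
        have h2 := hr k (by omega)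
        have h3 := hh_mono hk'
        calc _ ≤ ((n-k:ℕ):ℝ)⁻¹ * (K * (hh k / k)) := by gcongr
          _ ≤ ((n-k:ℕ):ℝ)⁻¹ * (K * (hh n / k)) := by gcongr
          _ = _ := by ring
    refine (Finset.sum_le_sum h1).trans ?_
    rw [Finset.sum_add_distrib, ← Finset.mul_sum, Finset.sum_ite_eq' , if_pos (by simp)]
    have h4 := mul_le_mul_of_nonneg_left (inv_conv n hn) (mul_nonneg hK (hh_nonneg n))
    have : K * hh n * (2 * (hh n / n)) = K * (2 * (hh n ^ 2 / n)) := by ring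
    linarith
  have h := hz.add (hh_sub_log.const_mul A)
  rw [zero_add] at h
  refine h.congr (fun n => ?_)
  have e : ∑ k ∈ Finset.range (n+1), ((n-k:ℕ):ℝ)⁻¹ * ((k:ℝ)^2 * p k - A) =
      ∑ k ∈ Finset.range n, ((n-k:ℕ):ℝ)⁻¹ * ((k:ℝ)^2 * p k) - A * hh n := by
    simp only [mul_sub, Finset.sum_sub_distrib]
    rw [← Finset.sum_mul, hh_reflect, Finset.sum_range_succ]
    simp
    ring
  rw [e]; ring

theorem CoreHyp.main (H : CoreHyp A B D σ p r s) :
    Tendsto (fun n : ℕ => (n:ℝ)^3 * p n - A * n - 2 * A^2 * Real.log n) atTop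
      (𝓝 (A^2 * (2 * Real.eulerMascheroniConstant - 1) + 2 * A * σ - B)) := by
  obtain ⟨C, hC, hb⟩ := H.bound
  have h4 := conv_sq s p D C (-B) A H.hs (fun n => by
    rw [abs_of_nonneg (mul_nonneg (by positivity) (H.hp n))]; exact hb n) H.hsl H.lim1
    H.hsσ.summable.abs H.hp1.summable.abs
  rw [H.hp1.tsum_eq, H.hsσ.tsum_eq] at h4
  have h := (((H.limT.const_mul (-A)).add (H.lim2.const_mul A)).add (H.lim3.const_mul A)).add h4
  have e : -A * A + A * (σ + A * Real.eulerMascheroniConstant) + A * (A * Real.eulerMascheroniConstant) +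
      (-B * 1 + A * σ) = A^2 * (2 * Real.eulerMascheroniConstant - 1) + 2 * A * σ - B := by ring
  rw [e] at h
  refine h.congr (fun n => ?_)
  rw [H.exp2, Finset.sum_range_succ, Nat.sub_self, H.hs0]
  ring

end

lemma hasDerivAt_ps (a : ℕ → ℝ) (A : ℝ) (ha : ∀ n : ℕ, |(n:ℝ) * a n| ≤ A) (x : ℝ) (hx : x ∈ Set.Ioo (0:ℝ) 1) :
    HasDerivAt (fun z => ∑' n, a n * z ^ n) (∑' n : ℕ, a n * (n * x ^ (n-1))) x := by
  obtain ⟨ρ, h1, h2⟩ := exists_between hx.2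
  have hρ0 : 0 < ρ := hx.1.trans h1
  refine hasDerivAt_tsum_of_isPreconnected (u := fun n : ℕ => A * ρ ^ (n-1)) (t := Set.Ioo (-ρ) ρ) (y₀ := 0)
    (g := fun (n : ℕ) (z : ℝ) => a n * z ^ n) (g' := fun (n : ℕ) (z : ℝ) => a n * (n * z ^ (n-1)))
    ?_ isOpen_Ioo isPreconnected_Ioo ?_ ?_ ?_ ?_ ?_
  · apply Summable.mul_left
    rw [← summable_nat_add_iff 1]
    simpa using summable_geometric_of_lt_one hρ0.le h2
  · intro n y _
    exact (hasDerivAt_pow n y).const_mul (a n)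
  · intro n y hy
    have hy' : |y| ≤ ρ := (abs_lt.2 hy).le
    have e : a n * (n * y ^ (n-1)) = (n * a n) * y ^ (n-1) := by ring
    rw [e, norm_mul, norm_pow, Real.norm_eq_abs, Real.norm_eq_abs]
    have := ha n
    gcongr
    exact (abs_nonneg _).trans this
  · exact ⟨by linarith, hρ0⟩
  · apply summable_of_ne_finset_zero (s := {0})
    intro n hn
    simp at hn
    simp [hn]
  · exact ⟨by linarith [hx.1], h1⟩

lemma x_mul_deriv (a : ℕ → ℝ) (x : ℝ) :
    x * (∑' n : ℕ, a n * (n * x ^ (n-1))) = ∑' n : ℕ, (n * a n) * x ^ n := by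
  rw [← tsum_mul_left]
  congr 1
  ext n
  rcases n with _ | n
  · simp
  · simp; ring

lemma summable_ps (a : ℕ → ℝ) (A : ℝ) (ha : ∀ n : ℕ, |a n| ≤ A) (x : ℝ) (hx : x ∈ Set.Ioo (0:ℝ) 1) :
    Summable (fun n => ‖a n * x ^ n‖) := by
  refine Summable.of_nonneg_of_le (fun _ => norm_nonneg _) (fun n => ?_)
    ((summable_geometric_of_lt_one hx.1.le hx.2).mul_left A)
  rw [norm_mul, norm_pow, Real.norm_eq_abs, Real.norm_eq_abs, abs_of_pos hx.1]
  have := ha n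
  have := hx.1
  gcongr

lemma cont_ps (a : ℕ → ℝ) (ha : Summable (fun n => |a n|)) :
    ContinuousOn (fun z => ∑' n, a n * z ^ n) (Set.Icc 0 1) := by
  refine continuousOn_tsum (fun n => by fun_prop) ha ?_
  intro n x hx
  rw [norm_mul, norm_pow, Real.norm_eq_abs, Real.norm_eq_abs, abs_of_nonneg hx.1]
  exact mul_le_of_le_one_right (abs_nonneg _) (pow_le_one₀ hx.1 hx.2)

section
variable {Q P : ℕ → ℝ} {A : ℝ}

lemma P_nonneg (hQ : ∀ j, 1 ≤ j → 0 ≤ Q j) (hP0 : P 0 = Real.exp (Q 0))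
    (hrec : ∀ n : ℕ, (n:ℝ) * P n = ∑ k ∈ Finset.range (n+1), (((n-k:ℕ):ℝ) * Q (n-k)) * P k) (n : ℕ) : 0 ≤ P n := by
  induction n using Nat.strong_induction_on with
  | _ n ih =>
    rcases Nat.eq_zero_or_pos n with rfl | hn
    · rw [hP0]; positivity
    have hn0 : (0:ℝ) < n := by exact_mod_cast hn
    have : 0 ≤ (n:ℝ) * P n := by
      rw [hrec, Finset.sum_range_succ]
      simp only [Nat.sub_self, Nat.cast_zero, zero_mul, add_zero]
      apply Finset.sum_nonneg
      intro k hk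
      have hk' := Finset.mem_range.1 hk
      exact mul_nonneg (mul_nonneg (by positivity) (hQ _ (by omega))) (ih k hk')
    exact nonneg_of_mul_nonneg_right this hn0

lemma rec_flip (hrec : ∀ n : ℕ, (n:ℝ) * P n = ∑ k ∈ Finset.range (n+1), (((n-k:ℕ):ℝ) * Q (n-k)) * P k) (n : ℕ) :
    (n:ℝ) * P n = ∑ k ∈ Finset.range (n+1), ((k:ℝ) * Q k) * P (n-k) := by
  rw [hrec, ← Finset.sum_range_reflect]
  apply Finset.sum_congr rfl
  intro k hk
  have hk' := Finset.mem_range.1 hk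
  have e1 : n - (n + 1 - 1 - k) = k := by omega
  have e2 : n + 1 - 1 - k = n - k := by omega
  rw [e1, e2]

lemma P_sum_le (hQ : ∀ j, 1 ≤ j → 0 ≤ Q j) (hP0 : P 0 = Real.exp (Q 0))
    (hQs : HasSum Q 0)
    (hrec : ∀ n : ℕ, (n:ℝ) * P n = ∑ k ∈ Finset.range (n+1), (((n-k:ℕ):ℝ) * Q (n-k)) * P k) (N : ℕ) :
    ∑ n ∈ Finset.range N, P n ≤ 1 := by
  have hp := P_nonneg hQ hP0 hrec
  rcases Nat.eq_zero_or_pos N with rfl | hN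
  · simp
  set F : ℝ → ℝ := fun x => ∑ n ∈ Finset.range N, P n * x ^ n with hF
  set L : ℝ → ℝ := fun x => ∑ n ∈ Finset.range N, Q n * x ^ n with hL
  have hFd : ∀ x, HasDerivAt F (∑ n ∈ Finset.range N, P n * (n * x ^ (n-1))) x := fun x =>
    HasDerivAt.fun_sum fun n _ => (hasDerivAt_pow n x).const_mul _
  have hLd : ∀ x, HasDerivAt L (∑ n ∈ Finset.range N, Q n * (n * x ^ (n-1))) x := fun x =>
    HasDerivAt.fun_sum fun n _ => (hasDerivAt_pow n x).const_mul _
  have hG : ∀ x, HasDerivAt (fun x => F x * Real.exp (- L x)) _ x := fun x => (hFd x).mul (hLd x).neg.exp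
  have key : AntitoneOn (fun x => F x * Real.exp (- L x)) (Set.Icc 0 1) := by
    apply antitoneOn_of_deriv_nonpos (convex_Icc 0 1)
    · exact fun x _ => (hG x).continuousAt.continuousWithinAt
    · exact fun x _ => (hG x).differentiableAt.differentiableWithinAt
    · intro x hx
      rw [interior_Icc] at hx
      rw [(hG x).deriv]
      have hx0 := hx.1
      have hm : ∀ a : ℕ → ℝ, x * ∑ n ∈ Finset.range N, a n * (n * x ^ (n-1)) = ∑ n ∈ Finset.range N, (n * a n) * x ^ n := by
        intro a
        rw [Finset.mul_sum]
        apply Finset.sum_congr rfl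
        intro n _
        rcases n with _ | n
        · simp
        · simp; ring
      have hle : x * ∑ n ∈ Finset.range N, P n * (n * x ^ (n-1)) ≤ (x * ∑ n ∈ Finset.range N, Q n * (n * x ^ (n-1))) * F x := by
        rw [hm, hm]
        have e : ∑ n ∈ Finset.range N, (n * P n) * x ^ n =
            ∑ j ∈ Finset.range N, ∑ k ∈ Finset.range (N-j), ((j * Q j) * x ^ j) * (P k * x ^ k) := by
          rw [← Finset.sum_range_diag_flip N (fun j k => ((j * Q j) * x ^ j) * (P k * x ^ k))]
          apply Finset.sum_congr rfl
          intro m _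
          rw [rec_flip hrec, Finset.sum_mul]
          apply Finset.sum_congr rfl
          intro k hk
          have hk' : k ≤ m := by have := Finset.mem_range.1 hk; omega
          obtain ⟨j, rfl⟩ := Nat.exists_eq_add_of_le hk'
          simp only [Nat.add_sub_cancel_left]
          rw [pow_add]; ring
        rw [e, Finset.sum_mul]
        apply Finset.sum_le_sum
        intro j _
        rw [← Finset.mul_sum]
        have hj : 0 ≤ (j * Q j) * x ^ j := by
          rcases Nat.eq_zero_or_pos j with rfl | h0
          · simp
          · have := hQ j h0; positivity
        apply mul_le_mul_of_nonneg_left _ hj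
        apply Finset.sum_le_sum_of_subset_of_nonneg
        · intro i; simp; omega
        · intro i _ _
          have := hp i
          positivity
      set F' := ∑ n ∈ Finset.range N, P n * (n * x ^ (n-1))
      set L' := ∑ n ∈ Finset.range N, Q n * (n * x ^ (n-1))
      have h1 : F' ≤ L' * F x := by
        by_contra hcon
        push Not at hcon
        nlinarith [mul_pos hx0 (sub_pos.2 hcon)]
      have := Real.exp_pos (- L x)
      simp only [Pi.neg_apply]
      nlinarith [mul_le_mul_of_nonneg_right h1 this.le]
  have h01 := key (Set.left_mem_Icc.2 zero_le_one) (Set.right_mem_Icc.2 zero_le_one) zero_le_one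
  simp only at h01
  obtain ⟨M, rfl⟩ := Nat.exists_eq_succ_of_ne_zero hN.ne'
  have hF0 : F 0 = P 0 := by simp [hF, Finset.sum_range_succ']
  have hL0 : L 0 = Q 0 := by simp [hL, Finset.sum_range_succ']
  have hL1 : L 1 ≤ 0 := by
    simp only [hL, one_pow, mul_one]
    apply sum_le_hasSum _ _ hQs
    intro i hi
    exact hQ i (by simp at hi; omega)
  have hF1 : F 1 = ∑ n ∈ Finset.range (M+1), P n := by simp [hF]
  rw [hF0, hL0, hP0, ← Real.exp_add, add_neg_cancel, Real.exp_zero, hF1] at h01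
  have h1 : 1 ≤ Real.exp (- L 1) := Real.one_le_exp (by linarith)
  have h0 : 0 ≤ ∑ n ∈ Finset.range (M+1), P n := Finset.sum_nonneg fun i _ => hp i
  calc _ ≤ (∑ n ∈ Finset.range (M+1), P n) * Real.exp (- L 1) := le_mul_of_one_le_right h0 h1
    _ ≤ 1 := h01

lemma P_hasSum (hQ : ∀ j, 1 ≤ j → 0 ≤ Q j) (hP0 : P 0 = Real.exp (Q 0))
    (hQs : HasSum Q 0) (hQA : ∀ j : ℕ, |(j:ℝ) * Q j| ≤ A)
    (hrec : ∀ n : ℕ, (n:ℝ) * P n = ∑ k ∈ Finset.range (n+1), (((n-k:ℕ):ℝ) * Q (n-k)) * P k) :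
    HasSum P 1 := by
  have hp := P_nonneg hQ hP0 hrec
  have hle := P_sum_le hQ hP0 hQs hrec
  have hs : Summable P := summable_of_sum_range_le hp hle
  have hA : 0 ≤ A := (abs_nonneg _).trans (hQA 0)
  have hPA : ∀ n : ℕ, |(n:ℝ) * P n| ≤ A := by
    intro n
    rw [hrec]
    refine (Finset.abs_sum_le_sum_abs _ _).trans ?_
    calc _ ≤ ∑ k ∈ Finset.range (n+1), A * P k := by
            apply Finset.sum_le_sum
            intro k _
            rw [abs_mul, abs_of_nonneg (hp k)]
            exact mul_le_mul_of_nonneg_right (hQA _) (hp k)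
      _ = A * ∑ k ∈ Finset.range (n+1), P k := by rw [Finset.mul_sum]
      _ ≤ A * 1 := mul_le_mul_of_nonneg_left (hle _) hA
      _ = A := mul_one A
  have hP1 : ∀ n, |P n| ≤ 1 := by
    intro n
    rw [abs_of_nonneg (hp n)]
    exact (Finset.single_le_sum (fun i _ => hp i) (Finset.self_mem_range_succ n)).trans (hle (n+1))
  set F : ℝ → ℝ := fun x => ∑' n, P n * x ^ n with hF
  set L : ℝ → ℝ := fun x => ∑' n, Q n * x ^ n with hL
  have hc : ContinuousOn (fun x => F x * Real.exp (- L x)) (Set.Icc 0 1) :=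
    (cont_ps P hs.abs).mul (Real.continuous_exp.comp_continuousOn (cont_ps Q hQs.summable.abs).neg)
  have hd : ∀ x ∈ Set.Ioo (0:ℝ) 1, HasDerivAt (fun x => F x * Real.exp (- L x)) 0 x := by
    intro x hx
    have h := (hasDerivAt_ps P A hPA x hx).mul (hasDerivAt_ps Q A hQA x hx).neg.exp
    refine h.congr_deriv ?_
    have e1 := x_mul_deriv P x
    have e2 := x_mul_deriv Q x
    have e3 := tsum_mul_tsum_eq_tsum_sum_range_of_summable_norm (summable_ps (fun n : ℕ => (n:ℝ) * Q n) A hQA x hx) (summable_ps P 1 hP1 x hx)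
    have e4 : ∑' n : ℕ, (n * P n) * x ^ n = (∑' n : ℕ, ((n:ℝ) * Q n) * x ^ n) * ∑' n, P n * x ^ n := by
      rw [e3]
      congr 1
      ext n
      rw [rec_flip hrec, Finset.sum_mul]
      apply Finset.sum_congr rfl
      intro k hk
      have hk' : k ≤ n := by have := Finset.mem_range.1 hk; omega
      obtain ⟨j, rfl⟩ := Nat.exists_eq_add_of_le hk'
      simp only [Nat.add_sub_cancel_left]
      rw [pow_add]; ring
    rw [← e1, ← e2] at e4
    have e5 := mul_left_cancel₀ hx.1.ne' (e4.trans (mul_assoc _ _ _))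
    rw [e5]
    simp only [Pi.neg_apply]
    ring
  obtain ⟨c, hc', he⟩ := exists_hasDerivAt_eq_slope _ (fun _ => (0:ℝ)) zero_lt_one hc hd
  have hz : ∀ a : ℕ → ℝ, ∑' n, a n * (0:ℝ) ^ n = a 0 := by
    intro a
    rw [tsum_eq_single 0]
    · simp
    · intro n hn; simp [hn]
  have hF0 : F 0 = P 0 := hz P
  have hL0 : L 0 = Q 0 := hz Q
  have hL1 : L 1 = 0 := by simp [hL, hQs.tsum_eq]
  have hF1 : F 1 = ∑' n, P n := by simp [hF]
  rw [hF0, hL0, hL1, hF1, hP0, ← Real.exp_add, add_neg_cancel, Real.exp_zero] at he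
  simp at he
  have : ∑' n, P n = 1 := by linarith
  rw [← this]
  exact hs.hasSum
end

lemma hs_of {f g : ℕ → ℝ} {a b : ℝ} (h : HasSum f a) (hf : ∀ m, g m = f m) (hab : b = a) : HasSum g b := by
  rw [hab, funext hf]; exact h

lemma poch_ratio (j m : ℕ) (hj : 1 ≤ j) :
    (ascPochhammer ℝ m).eval (j : ℝ) / (ascPochhammer ℝ m).eval (2 + (j : ℝ)) =
      (j * (j+1)) / ((j+m) * (j+m+1)) := by
  have hj0 : (0:ℝ) < j := by exact_mod_cast hj
  induction m with
  | zero => simp; field_simp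
  | succ m ih =>
    rw [ascPochhammer_succ_eval, ascPochhammer_succ_eval, mul_div_mul_comm, ih]
    push_cast
    field_simp
    ring

lemma fubini (F : ℕ × ℕ → ℝ) (c : ℕ → ℝ) (S : ℝ) (hF : Summable F)
    (hc : ∀ m, HasSum (fun j => F (j, m)) (c m)) (hS : HasSum c S) :
    HasSum (fun j => ∑' m, F (j, m)) S := by
  have h1 : HasSum (fun j => ∑' m, F (j, m)) (∑' x, F x) :=
    hF.hasSum.prod_fiberwise (fun j => (hF.prod_factor j).hasSum)
  have h2 : HasSum c (∑' x : ℕ × ℕ, F x.swap) :=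
    hF.prod_symm.hasSum.prod_fiberwise (fun m => hc m)
  have h3 : ∑' x : ℕ × ℕ, F x.swap = ∑' x, F x := (Equiv.prodComm ℕ ℕ).tsum_eq F
  rw [h3] at h2
  rwa [h2.unique hS] at h1

lemma tele (m : ℕ) : HasSum (fun j : ℕ => (1:ℝ) / (((j:ℝ)+1+m) * (j+1+m+1))) (1 / (1 + m)) := by
  rw [hasSum_iff_tendsto_nat_of_nonneg (fun j => by positivity)]
  have h : ∀ N : ℕ, ∑ j ∈ Finset.range N, (1:ℝ) / (((j:ℝ)+1+m) * (j+1+m+1)) = 1 / (1+m) - 1 / ((N + m : ℕ) + 1) := by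
    intro N
    induction N with
    | zero => simp [add_comm]
    | succ N ih =>
      rw [Finset.sum_range_succ, ih]
      push_cast
      field_simp
      ring
  simp only [h]
  have := (tendsto_one_div_add_atTop_nhds_zero_nat (𝕜 := ℝ)).comp (tendsto_add_atTop_nat m)
  simpa using this.const_sub ((1:ℝ) / (1+m))

noncomputable def ff (j m : ℕ) : ℝ := j / (((j:ℝ)+m) * (j+m+1)) - (j:ℝ)⁻¹

lemma ff_nonpos (j m : ℕ) : ff j m ≤ 0 := by
  unfold ff
  rcases Nat.eq_zero_or_pos j with rfl | h
  · simp
  have : (0:ℝ) < j := by exact_mod_cast h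
  rw [sub_nonpos, inv_eq_one_div, div_le_div_iff₀ (by positivity) (by positivity)]
  have : (0:ℝ) ≤ m := by positivity
  nlinarith [mul_nonneg this this]

lemma ff_bound (j m : ℕ) : |(j:ℝ)^2 * ff j m| ≤ (m:ℝ)^2 + 3 * m + 1 := by
  rcases Nat.eq_zero_or_pos j with rfl | h
  · simp; positivity
  rw [abs_mul, abs_of_nonpos (ff_nonpos j m), abs_of_nonneg (by positivity)]
  have hj : (1:ℝ) ≤ j := by exact_mod_cast h
  have hm : (0:ℝ) ≤ m := by positivity
  have e : (j:ℝ)^2 * - ff j m = j * ((2*m+1) * j + m^2 + m) / ((j+m) * (j+m+1)) := by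
    unfold ff; field_simp; ring
  rw [e, div_le_iff₀ (by positivity)]
  have h1 : (2*m+1) * (j:ℝ) + m^2 + m ≤ (m^2+3*m+1) * j := by nlinarith [mul_nonneg (by positivity : (0:ℝ) ≤ m^2+m) (sub_nonneg.2 hj)]
  have h2 : (j:ℝ) * j ≤ (j+m)*(j+m+1) := by nlinarith [mul_nonneg hm hm]
  calc (j:ℝ) * ((2*m+1) * j + m^2 + m) ≤ (j:ℝ) * (((m:ℝ)^2+3*m+1) * j) := by gcongr
    _ = ((m:ℝ)^2+3*m+1) * (j * j) := by ring
    _ ≤ _ := by gcongr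

lemma ff_lim (m : ℕ) : Tendsto (fun j : ℕ => (j:ℝ)^2 * ff j m) atTop (𝓝 (-(2*m+1))) := by
  have hi : Tendsto (fun j : ℕ => (j:ℝ)⁻¹) atTop (𝓝 0) := tendsto_inv_atTop_nhds_zero_nat
  have h : Tendsto (fun j : ℕ => -((2*m+1) + (m^2+m) * (j:ℝ)⁻¹) / ((1 + m * (j:ℝ)⁻¹) * (1 + (m+1) * (j:ℝ)⁻¹)))
      atTop (𝓝 (-((2*m+1) + (m^2+m) * 0) / ((1 + m * 0) * (1 + (m+1) * (0:ℝ))))) :=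
    (((hi.const_mul _).const_add _).neg).div
      (((hi.const_mul _).const_add _).mul ((hi.const_mul _).const_add _)) (by simp)
  simp only [mul_zero, add_zero, mul_one, div_one] at h
  refine h.congr' ?_
  filter_upwards [eventually_ge_atTop 1] with j hj
  have : (0:ℝ) < j := by exact_mod_cast hj
  unfold ff
  field_simp
  ring

lemma hh_succ (n : ℕ) : hh (n+1) = hh n + ((n:ℝ)+1)⁻¹ := by
  unfold hh
  rw [Finset.sum_range_succ _ (n+1)]
  push_cast; rfl

lemma hh_shift (m : ℕ) : Tendsto (fun N : ℕ => hh (N+m) - hh N) atTop (𝓝 0) := by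
  induction m with
  | zero => simp
  | succ m ih =>
    have h := (tendsto_one_div_add_atTop_nhds_zero_nat (𝕜 := ℝ)).comp (tendsto_add_atTop_nat m)
    have h2 := ih.add h
    rw [add_zero] at h2
    refine h2.congr fun N => ?_
    rw [← add_assoc, hh_succ]
    simp
    ring

lemma ff_partial (m N : ℕ) : ∑ j ∈ Finset.range (N+1), ff j m = hh (N+m) - hh m - hh N - N / ((N:ℝ)+m+1) := by
  induction N with
  | zero => simp [ff, hh]
  | succ N ih =>
    rw [Finset.sum_range_succ, ih, hh_succ, show N+1+m = N+m+1 by ring, hh_succ]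
    unfold ff
    push_cast
    field_simp
    ring

lemma ff_sum (m : ℕ) (hs : Summable (fun j => ff j m)) : HasSum (fun j => ff j m) (-hh m - 1) := by
  have h1 := hs.hasSum.tendsto_sum_nat.comp (tendsto_add_atTop_nat 1)
  have h2 : Tendsto (fun N : ℕ => ∑ j ∈ Finset.range (N+1), ff j m) atTop (𝓝 (-hh m - 1)) := by
    have hq : Tendsto (fun N : ℕ => (N:ℝ) / ((N:ℝ)+((m:ℝ)+1))) atTop (𝓝 1) := by
      exact tendsto_natCast_div_add_atTop ((m:ℝ)+1)
    have h := ((hh_shift m).sub_const (hh m)).sub hq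
    rw [zero_sub] at h
    refine h.congr fun N => ?_
    rw [ff_partial]
    rw [← add_assoc]
    ring
  have := tendsto_nhds_unique h1 h2
  rw [← this]
  exact hs.hasSum

lemma log_ps (q : ℝ) (hq0 : 0 ≤ q) (hq1 : q < 1) : HasSum (fun m : ℕ => q ^ m * hh m) (- Real.log (1 - q) / (1 - q)) := by
  have h1 : HasSum (fun n : ℕ => (n:ℝ)⁻¹ * q ^ n) (- Real.log (1-q)) := by
    rw [← hasSum_nat_add_iff' 1]
    have := Real.hasSum_pow_div_log_of_abs_lt_one (x := q) (by rw [abs_of_nonneg hq0]; exact hq1)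
    simp only [Finset.range_one, Finset.sum_singleton, Nat.cast_zero, inv_zero, zero_mul, sub_zero]
    refine hs_of this (fun n => ?_) rfl
    push_cast; rw [div_eq_mul_inv, mul_comm]
  have h2 := hasSum_geometric_of_lt_one hq0 hq1
  have n1 := h1.summable.norm
  have n2 := h2.summable.norm
  have hs := (summable_norm_sum_mul_range_of_summable_norm n1 n2).of_norm
  have ht := tsum_mul_tsum_eq_tsum_sum_range_of_summable_norm n1 n2
  rw [h1.tsum_eq, h2.tsum_eq] at ht
  have h3 := hs.hasSum
  rw [← ht] at h3
  rw [div_eq_mul_inv]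
  refine hs_of h3 (fun m => ?_) rfl
  unfold hh
  rw [Finset.mul_sum]
  apply Finset.sum_congr rfl
  intro k hk
  have hk' : k ≤ m := by have := Finset.mem_range.1 hk; omega
  obtain ⟨j, rfl⟩ := Nat.exists_eq_add_of_le hk'
  simp only [Nat.add_sub_cancel_left]
  rw [pow_add]; ring

lemma poly_sum (q : ℝ) (hq0 : 0 ≤ q) (hq1 : q < 1) : Summable (fun m : ℕ => q ^ m * ((m:ℝ)^2 + 3 * m + 1)) := by
  have hn : ‖q‖ < 1 := by rw [Real.norm_eq_abs, abs_of_nonneg hq0]; exact hq1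
  have h2 := summable_pow_mul_geometric_of_norm_lt_one 2 hn
  have h1 := (summable_pow_mul_geometric_of_norm_lt_one 1 hn).mul_left 3
  have h0 := summable_geometric_of_lt_one hq0 hq1
  refine ((h2.add h1).add h0).congr fun m => ?_
  simp; ring

theorem core_inst
    (q θ : ℝ) (hq0 : 0 ≤ q) (hq1 : q < 1) (hθ : 0 < θ)
    (Q P : ℕ → ℝ)
    (hQ0 : Q 0 = -θ * ∑' m : ℕ, q ^ m / (1 + m))
    (hQ : ∀ j : ℕ, 1 ≤ j →
      Q j = θ * (1 / ((j : ℝ) * (j + 1))) *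
        ∑' m : ℕ,
          ((ascPochhammer ℝ m).eval (j : ℝ) / (ascPochhammer ℝ m).eval (2 + (j : ℝ))) * q ^ m)
    (hP0 : P 0 = Real.exp (Q 0))
    (hP : ∀ n : ℕ, 1 ≤ n →
      P n = (1 / (n : ℝ)) * ∑ k ∈ Finset.range n, ((n : ℝ) - k) * Q (n - k) * P k) :
    CoreHyp (θ * (1 - q)⁻¹) (θ * ((1+q) / (1-q)^2)) (θ * ∑' m : ℕ, q ^ m * ((m:ℝ)^2 + 3 * m + 1))
      (θ * (Real.log (1-q) / (1-q) - (1-q)⁻¹)) P (fun j => j * Q j)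
      (fun j => θ * ∑' m : ℕ, q ^ m * ff j m) := by
  have hq' : 0 < 1 - q := by linarith
  have hgeo := hasSum_geometric_of_lt_one hq0 hq1
  have hpoly := poly_sum q hq0 hq1
  -- rewriting Q
  have hQ' : ∀ j : ℕ, Q (j+1) = θ * ∑' m : ℕ, q ^ m * (1 / (((j:ℝ)+1+m) * (j+1+m+1))) := by
    intro j
    rw [hQ (j+1) (by omega), mul_assoc, ← tsum_mul_left]
    congr 1
    apply tsum_congr
    intro m
    rw [poch_ratio (j+1) m (by omega)]
    push_cast
    field_simp
  have hFs : Summable (fun x : ℕ × ℕ => q ^ x.2 * (1 / (((x.1:ℝ)+1+x.2) * (x.1+1+x.2+1)))) := by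
    have h := (tele 0).summable.mul_of_nonneg hgeo.summable (fun j => by positivity) (fun m => by positivity)
    refine Summable.of_nonneg_of_le (fun x => by positivity) (fun x => ?_) h
    rw [mul_comm]
    gcongr <;> simp
  have hsm : ∀ j : ℕ, Summable (fun m : ℕ => q ^ m * (1 / (((j:ℝ)+1+m) * (j+1+m+1)))) := fun j => hFs.prod_factor j
  have hcs : Summable (fun m : ℕ => q ^ m * (1 / (1 + (m:ℝ)))) := by
    refine Summable.of_nonneg_of_le (fun x => by positivity) (fun m => ?_) hgeo.summable
    apply mul_le_of_le_one_right (by positivity)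
    rw [div_le_one (by positivity)]
    have : (0:ℝ) ≤ m := by positivity
    linarith
  have hQs1 : HasSum (fun j => Q (j+1)) (θ * ∑' m : ℕ, q ^ m * (1 / (1 + (m:ℝ)))) := by
    have := (fubini _ (fun m => q ^ m * (1 / (1 + (m:ℝ)))) _ hFs (fun m => (tele m).mul_left _) hcs.hasSum).mul_left θ
    simpa only [← hQ'] using this
  have hQs : HasSum Q 0 := by
    rw [← hasSum_nat_add_iff' 1]
    refine hs_of hQs1 (fun m => rfl) ?_
    simp [hQ0, div_eq_mul_inv]
  have hQn : ∀ j, 1 ≤ j → 0 ≤ Q j := by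
    intro j hj
    obtain ⟨i, rfl⟩ := Nat.exists_eq_succ_of_ne_zero (show j ≠ 0 by omega)
    rw [Nat.succ_eq_add_one, hQ']
    exact mul_nonneg hθ.le (tsum_nonneg fun m => by positivity)
  -- s
  have hfs : ∀ j : ℕ, Summable (fun m : ℕ => q ^ m * ff j m) := by
    intro j
    rcases Nat.eq_zero_or_pos j with rfl | h
    · simp [ff, summable_zero]
    refine Summable.of_norm_bounded hpoly (fun m => ?_)
    rw [norm_mul, Real.norm_eq_abs, abs_of_nonneg (by positivity)]
    gcongr
    have h1 := ff_bound j m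
    rw [abs_mul, abs_of_nonneg (by positivity)] at h1
    refine le_trans ?_ h1
    apply le_mul_of_one_le_left (abs_nonneg _)
    have : (1:ℝ) ≤ j := by exact_mod_cast h
    nlinarith
  have hrs : ∀ j : ℕ, (j:ℝ) * Q j = θ * (1 - q)⁻¹ * (j:ℝ)⁻¹ + θ * ∑' m : ℕ, q ^ m * ff j m := by
    intro j
    rcases j with _ | j
    · simp [ff]
    rw [hQ', mul_assoc θ, ← mul_add, ← hgeo.tsum_eq, ← tsum_mul_right, 
      ← (hgeo.summable.mul_right _).tsum_add (hfs _), mul_left_comm, ← tsum_mul_left]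
    congr 1
    apply tsum_congr
    intro m
    unfold ff
    push_cast
    ring
  have hsnp : ∀ j : ℕ, θ * ∑' m : ℕ, q ^ m * ff j m ≤ 0 := fun j =>
    mul_nonpos_of_nonneg_of_nonpos hθ.le (tsum_nonpos fun m => mul_nonpos_of_nonneg_of_nonpos (by positivity) (ff_nonpos j m))
  have hr0 : ∀ j : ℕ, 0 ≤ (j:ℝ) * Q j := by
    intro j
    rcases Nat.eq_zero_or_pos j with rfl | h
    · simp
    exact mul_nonneg (by positivity) (hQn j h)
  have hrA : ∀ j : ℕ, (j:ℝ) * Q j ≤ θ * (1 - q)⁻¹ * (j:ℝ)⁻¹ := fun j => by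
    rw [hrs]; linarith [hsnp j]
  have hA : 0 < θ * (1 - q)⁻¹ := by positivity
  have hrec : ∀ n : ℕ, (n:ℝ) * P n = ∑ k ∈ Finset.range (n+1), (((n-k:ℕ):ℝ) * Q (n-k)) * P k := by
    intro n
    rcases Nat.eq_zero_or_pos n with rfl | h
    · simp
    have hn : (n:ℝ) ≠ 0 := by positivity
    rw [hP n h, ← mul_assoc, mul_one_div_cancel hn, one_mul, Finset.sum_range_succ]
    simp only [Nat.sub_self, Nat.cast_zero, zero_mul, add_zero]
    apply Finset.sum_congr rfl
    intro k hk
    rw [Nat.cast_sub (Finset.mem_range.1 hk).le]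
  have hQA : ∀ j : ℕ, |(j:ℝ) * Q j| ≤ θ * (1 - q)⁻¹ := by
    intro j
    rw [abs_of_nonneg (hr0 j)]
    refine (hrA j).trans (mul_le_of_le_one_right hA.le ?_)
    exact Nat.cast_inv_le_one j
  have hsq : ∀ j : ℕ, (j:ℝ)^2 * (θ * ∑' m : ℕ, q ^ m * ff j m) = θ * ∑' m : ℕ, q ^ m * ((j:ℝ)^2 * ff j m) := by
    intro j
    rw [mul_left_comm, ← tsum_mul_left]
    congr 1
    exact tsum_congr fun m => by ring
  have hbd : ∀ j m : ℕ, ‖q ^ m * ((j:ℝ)^2 * ff j m)‖ ≤ q ^ m * ((m:ℝ)^2 + 3 * m + 1) := by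
    intro j m
    rw [norm_mul, Real.norm_eq_abs, abs_of_nonneg (by positivity), Real.norm_eq_abs]
    have := ff_bound j m
    gcongr
  have hsummff : Summable (fun x : ℕ × ℕ => q ^ x.2 * ff x.1 x.2) := by
    have hsq : Summable (fun j : ℕ => ((j:ℝ)^2)⁻¹) := by
      have := Real.summable_nat_pow_inv (p := 2)
      simp [this]
    have h := hsq.mul_of_nonneg hpoly (fun j => by positivity) (fun m => by positivity)
    refine Summable.of_norm_bounded h (fun x => ?_)
    obtain ⟨j, m⟩ := x
    simp only
    rcases Nat.eq_zero_or_pos j with rfl | hj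
    · simp [ff]
    have hj0 : (0:ℝ) < j := by exact_mod_cast hj
    calc ‖q ^ m * ff j m‖ = ((j:ℝ)^2)⁻¹ * ‖q ^ m * ((j:ℝ)^2 * ff j m)‖ := by
          simp only [norm_mul, norm_pow, Real.norm_eq_abs, Nat.abs_cast]; field_simp
      _ ≤ _ := by have := hbd j m; gcongr
  have hffs : ∀ m, Summable (fun j => ff j m) := by
    intro m
    have hsq : Summable (fun j : ℕ => ((j:ℝ)^2)⁻¹) := by
      have := Real.summable_nat_pow_inv (p := 2)
      simp [this]
    refine Summable.of_norm_bounded (hsq.mul_left ((m:ℝ)^2 + 3 * m + 1)) (fun j => ?_)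
    rcases Nat.eq_zero_or_pos j with rfl | hj
    · simp [ff]
    have hj0 : (0:ℝ) < j := by exact_mod_cast hj
    have := ff_bound j m
    rw [abs_mul, abs_of_nonneg (by positivity)] at this
    rw [← div_eq_mul_inv, le_div_iff₀ (by positivity), Real.norm_eq_abs]
    linarith
  refine ⟨hA, P_nonneg hQn hP0 hrec, P_hasSum hQn hP0 hQs hQA hrec, hrec, hrs, ?_, hr0, hrA, ?_, ?_, ?_⟩
  · simp [ff]
  · intro n
    rw [hsq, abs_mul, abs_of_pos hθ]
    gcongr
    exact tsum_of_norm_bounded hpoly.hasSum (hbd n)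
  · simp only [hsq]
    rw [← mul_neg]
    apply Tendsto.const_mul
    have h := tendsto_tsum_of_dominated_convergence (𝓕 := atTop)
      (f := fun (j m : ℕ) => q ^ m * ((j:ℝ)^2 * ff j m)) (g := fun m => q ^ m * (-(2*m+1))) hpoly
      (fun m => (ff_lim m).const_mul _) (Eventually.of_forall hbd)
    have hn : ‖q‖ < 1 := by rw [Real.norm_eq_abs, abs_of_nonneg hq0]; exact hq1
    have hc := (hasSum_coe_mul_geometric_of_norm_lt_one hn)
    have e : HasSum (fun m : ℕ => q ^ m * (-(2*(m:ℝ)+1))) (-((1+q) / (1-q)^2)) := by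
      have := ((hc.mul_left 2).add hgeo).neg
      refine hs_of this (fun m => by ring) ?_
      field_simp; ring
    rwa [e.tsum_eq] at h
  · apply HasSum.mul_left
    refine fubini _ (fun m => q ^ m * (-hh m - 1)) _ hsummff (fun m => (ff_sum m (hffs m)).mul_left _) ?_
    have := ((log_ps q hq0 hq1).add hgeo).neg
    exact hs_of this (fun m => by ring) (by ring)

/-- Refined tail expansion of the neutral (`γ = 1`) LPSM-limit mutant distribution:
`p_n ∼ θ/((1−q)n²) + (2θ²/(1−q)²)(log n)/n³
     + [θ²(2C_E−3+2log(1−q)) − θ(1+q)]/((1−q)²n³) + O(n⁻⁴)`. -/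
theorem lpsm_neutral_tail_refined
    (q θ : ℝ) (hq0 : 0 ≤ q) (hq1 : q < 1) (hθ : 0 < θ)
    (Q P : ℕ → ℝ)
    (hQ0 : Q 0 = -θ * ∑' m : ℕ, q ^ m / (1 + m))
    (hQ : ∀ j : ℕ, 1 ≤ j →
      Q j = θ * (1 / ((j : ℝ) * (j + 1))) *
        ∑' m : ℕ,
          ((ascPochhammer ℝ m).eval (j : ℝ) / (ascPochhammer ℝ m).eval (2 + (j : ℝ))) * q ^ m)
    (hP0 : P 0 = Real.exp (Q 0))
    (hP : ∀ n : ℕ, 1 ≤ n →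
      P n = (1 / (n : ℝ)) * ∑ k ∈ Finset.range n, ((n : ℝ) - k) * Q (n - k) * P k) :
    Tendsto
      (fun n : ℕ =>
        (n : ℝ) ^ 3 * (P n - θ / ((1 - q) * (n : ℝ) ^ 2))
          - (2 * θ ^ 2 / (1 - q) ^ 2) * Real.log n)
      atTop
      (nhds ((θ ^ 2 * (2 * Real.eulerMascheroniConstant - 3 + 2 * Real.log (1 - q))
        - θ * (1 + q)) / (1 - q) ^ 2)) := by
  have hq' : 1 - q ≠ 0 := by linarith
  have h := (core_inst q θ hq0 hq1 hθ Q P hQ0 hQ hP0 hP).main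
  have e : (θ * (1 - q)⁻¹) ^ 2 * (2 * Real.eulerMascheroniConstant - 1) +
      2 * (θ * (1 - q)⁻¹) * (θ * (Real.log (1-q) / (1-q) - (1-q)⁻¹)) - θ * ((1+q) / (1-q)^2) =
      (θ ^ 2 * (2 * Real.eulerMascheroniConstant - 3 + 2 * Real.log (1 - q))
        - θ * (1 + q)) / (1 - q) ^ 2 := by
    field_simp
    ring
  rw [e] at h
  refine h.congr' ?_
  filter_upwards [eventually_ge_atTop 1] with n hn
  have hn0 : (n:ℝ) ≠ 0 := by positivity
  field_simp
end

section
/- Let N > 1 be real, θ > 0, φ = 1 − 1/N and μ = θ/N. Define q_0 = −θφ and q_k = θ(φ^k/k − φ^{k+1}/(k+1)) for k ≥ 1, and define p : ℕ → ℝ by p_0 = e^{q_0} and p_n = (1/n) ∑_{k=0}^{n−1} (n−k) q_{n−k} p_k for n ≥ 1. Then lim_{n→∞} p_n · Γ(μ) · n^{1−μ} · φ^{−n} = 1. -/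
open Filter Topology

noncomputable def bs (κ : ℝ) : ℕ → ℝ
  | 0 => 1
  | n+1 => (∑ k : Fin (n+1), κ / (((n - (k:ℕ) : ℕ) : ℝ) + 2) * bs κ k) / ((n:ℝ)+1)
decreasing_by exact k.2

lemma bs_succ (κ : ℝ) (n : ℕ) : ((n:ℝ)+1) * bs κ (n+1) =
    ∑ k ∈ Finset.range (n+1), κ / (((n - k : ℕ) : ℝ) + 2) * bs κ k := by
  rw [bs, Finset.sum_range]
  field_simp

lemma tannery (b c : ℕ → ℝ) (hb : Summable fun k => |b k|) (hc : ∀ n, 0 < c n) (hm : Monotone c)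
    (hr : Tendsto (fun n => c n / c (n+1)) atTop (𝓝 1)) :
    Tendsto (fun n => (∑ k ∈ Finset.range (n+1), b k * c (n-k)) / c n) atTop (𝓝 (∑' k, b k)) := by
  have h1 : ∀ k, Tendsto (fun n => c (n-k) / c n) atTop (𝓝 1) := by
    intro k
    rw [← tendsto_add_atTop_iff_nat k]
    simp only [Nat.add_sub_cancel]
    induction k with
    | zero => simp [fun n => div_self (hc n).ne']
    | succ k ih =>
      have := ih.mul (hr.comp (tendsto_add_atTop_nat k))
      rw [mul_one] at this
      refine this.congr fun n => ?_
      have := (hc (n+k)).ne'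
      have := (hc (n+k+1)).ne'
      simp only [Function.comp, ← add_assoc]
      field_simp
  have h2 := tendsto_tsum_of_dominated_convergence (𝓕 := atTop)
    (f := fun n k => if k ≤ n then b k * (c (n-k) / c n) else 0) (g := b) hb ?_ ?_
  · refine h2.congr fun n => ?_
    rw [tsum_eq_sum (s := Finset.range (n+1)), Finset.sum_div]
    · refine Finset.sum_congr rfl fun k hk => ?_
      rw [if_pos (by simpa [Nat.lt_succ_iff] using hk), mul_div_assoc]
    · intro k hk
      rw [if_neg (by simpa [Nat.lt_succ_iff] using hk)]
  · intro k
    have := (h1 k).const_mul (b k)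
    rw [mul_one] at this
    refine this.congr' ?_
    filter_upwards [eventually_ge_atTop k] with n hn
    rw [if_pos hn]
  · refine Eventually.of_forall fun n k => ?_
    split_ifs
    · rw [norm_mul, Real.norm_eq_abs, Real.norm_eq_abs, abs_of_nonneg (div_nonneg (hc _).le (hc _).le)]
      refine mul_le_of_le_one_right (abs_nonneg _) ?_
      rw [div_le_one (hc _)]
      exact hm (Nat.sub_le _ _)
    · simp

lemma hasDerivAt_series (f : ℕ → ℝ) (M : ℝ) (hf : ∀ n, |f n| ≤ M) (w : ℝ) (hw0 : 0 ≤ w) (hw : w < 1) :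
    HasDerivAt (fun x => ∑' n, f n * x ^ n) (∑' n : ℕ, ((n:ℝ)+1) * f (n+1) * w ^ n) w := by
  obtain ⟨r, hr1, hr2⟩ := exists_between hw
  have hr0 : 0 < r := hw0.trans_lt hr1
  have hs : Summable fun n : ℕ => (n:ℝ) * r ^ (n-1) * M := by
    refine Summable.mul_right _ ?_
    rw [← summable_nat_add_iff 1]
    have := (summable_pow_mul_geometric_of_norm_lt_one (R := ℝ) 1 (r := r) (by rw [Real.norm_eq_abs, abs_of_pos hr0]; exact hr2)).add
      (summable_geometric_of_lt_one hr0.le hr2)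
    refine this.congr fun n => ?_
    simp; ring
  have key := hasDerivAt_tsum_of_isPreconnected (𝕜 := ℝ) (g := fun n x => f n * x ^ n)
    (g' := fun n x => f n * ((n:ℝ) * x ^ (n-1))) (t := Set.Ioo (-r) r) (y₀ := 0) (y := w) hs isOpen_Ioo
    isPreconnected_Ioo ?_ ?_ ?_ ?_ ?_
  · have e : (∑' n : ℕ, ((n:ℝ)+1) * f (n+1) * w ^ n) = ∑' n : ℕ, f n * ((n:ℝ) * w ^ (n-1)) := ?_
    · rw [e]; exact key
    symm
    rw [Summable.tsum_eq_zero_add]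
    · simp only [Nat.cast_zero, zero_mul, mul_zero, zero_add, Nat.add_sub_cancel]
      refine tsum_congr fun n => ?_
      push_cast; ring
    · refine Summable.of_norm_bounded hs fun n => ?_
      rw [norm_mul, norm_mul, norm_pow, Real.norm_eq_abs, Real.norm_eq_abs, Real.norm_eq_abs, abs_of_nonneg hw0, Nat.abs_cast, mul_comm]
      have := hf n
      gcongr
  · intro n y _
    exact (hasDerivAt_pow n y).const_mul _
  · intro n y hy
    rw [norm_mul, norm_mul, norm_pow, Real.norm_eq_abs, Real.norm_eq_abs, Real.norm_eq_abs, Nat.abs_cast, mul_comm]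
    have := hf n
    have : |y| ≤ r := (abs_lt.2 hy).le
    gcongr
  · constructor <;> linarith
  · refine summable_of_ne_finset_zero (s := {0}) fun n hn => ?_
    have : n ≠ 0 := by simpa using hn
    simp [this]
  · constructor <;> linarith

lemma hasSum_tele : HasSum (fun k : ℕ => 1 / (((k:ℝ)+1) * ((k:ℝ)+2))) 1 := by
  rw [hasSum_iff_tendsto_nat_of_nonneg (fun k => by positivity)]
  have : ∀ n : ℕ, ∑ k ∈ Finset.range n, 1 / (((k:ℝ)+1) * ((k:ℝ)+2)) = 1 - 1 / ((n:ℝ)+1) := by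
    intro n
    induction n with
    | zero => simp
    | succ n ih => rw [Finset.sum_range_succ, ih]; push_cast; field_simp; ring
  simp only [this]
  simpa using (tendsto_one_div_add_atTop_nhds_zero_nat (𝕜 := ℝ)).const_sub 1

lemma bs_nonneg (κ : ℝ) (hκ : 0 < κ) (n : ℕ) : 0 ≤ bs κ n := by
  induction n using Nat.strong_induction_on with
  | _ n ih =>
    cases n with
    | zero => simp [bs]
    | succ n =>
      have h := bs_succ κ n
      have : 0 ≤ ((n:ℝ)+1) * bs κ (n+1) := by
        rw [h]
        refine Finset.sum_nonneg fun k hk => ?_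
        have := ih k (Finset.mem_range.1 hk)
        positivity
      exact nonneg_of_mul_nonneg_right this (by positivity)

lemma bs_partial (κ : ℝ) (hκ : 0 < κ) (n : ℕ) :
    ∑ k ∈ Finset.range (n+1), bs κ k ≤ Real.exp κ := by
  set B : ℝ → ℝ := fun x => ∑ k ∈ Finset.range (n+1), bs κ k * x ^ k with hB
  set h : ℝ → ℝ := fun x => ∑ j ∈ Finset.range n, κ / (((j:ℝ)+1) * ((j:ℝ)+2)) * x ^ (j+1) with hh
  have dB : ∀ x, HasDerivAt B (∑ m ∈ Finset.range n, ((m:ℝ)+1) * bs κ (m+1) * x ^ m) x := by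
    intro x
    have := HasDerivAt.fun_sum (u := Finset.range (n+1)) (x := x)
      (fun k _ => (hasDerivAt_pow k x).const_mul (bs κ k))
    rw [Finset.sum_range_succ'] at this
    simp only [Nat.cast_zero, zero_mul, mul_zero, add_zero, Nat.add_sub_cancel] at this
    refine this.congr_deriv (Finset.sum_congr rfl fun m _ => ?_)
    push_cast; ring
  have dh : ∀ x, HasDerivAt h (∑ j ∈ Finset.range n, κ / ((j:ℝ)+2) * x ^ j) x := by
    intro x
    have := HasDerivAt.fun_sum (u := Finset.range n) (x := x)
      (fun j _ => (hasDerivAt_pow (j+1) x).const_mul (κ / (((j:ℝ)+1) * ((j:ℝ)+2))))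
    simp only [Nat.add_sub_cancel] at this
    refine this.congr_deriv (Finset.sum_congr rfl fun m _ => ?_)
    push_cast; field_simp
  have dF : ∀ x, HasDerivAt (fun x => B x * Real.exp (-h x)) _ x :=
    fun x => (dB x).mul (dh x).neg.exp
  have anti : AntitoneOn (fun x => B x * Real.exp (-h x)) (Set.Icc 0 1) := by
    refine antitoneOn_of_deriv_nonpos (convex_Icc 0 1)
      (fun x _ => (dF x).continuousAt.continuousWithinAt)
      (fun x _ => (dF x).differentiableAt.differentiableWithinAt) ?_
    intro x hx
    rw [interior_Icc] at hx
    have hx0 : 0 < x := hx.1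
    rw [(dF x).deriv, Pi.neg_apply]
    have key : (∑ m ∈ Finset.range n, ((m:ℝ)+1) * bs κ (m+1) * x ^ m) ≤
        B x * (∑ j ∈ Finset.range n, κ / ((j:ℝ)+2) * x ^ j) := by
      have e1 : (∑ m ∈ Finset.range n, ((m:ℝ)+1) * bs κ (m+1) * x ^ m) =
          ∑ m ∈ Finset.range n, ∑ k ∈ Finset.range (m+1),
            (fun k j : ℕ => bs κ k * x ^ k * (κ / ((j:ℝ)+2) * x ^ j)) k (m-k) := by
        refine Finset.sum_congr rfl fun m _ => ?_
        rw [bs_succ, Finset.sum_mul]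
        refine Finset.sum_congr rfl fun k hk => ?_
        have : x ^ m = x ^ k * x ^ (m-k) := by
          rw [← pow_add]; congr 1; have := Finset.mem_range.1 hk; omega
        rw [this]; ring
      rw [e1, Finset.sum_range_diag_flip n
        (fun k j : ℕ => bs κ k * x ^ k * (κ / ((j:ℝ)+2) * x ^ j)), hB, Finset.sum_mul]
      refine (Finset.sum_le_sum fun k _ => ?_).trans
        (Finset.sum_le_sum_of_subset_of_nonneg (Finset.range_subset_range.2 (Nat.le_succ n)) ?_)
      · rw [← Finset.mul_sum]
        refine mul_le_mul_of_nonneg_left ?_ (mul_nonneg (bs_nonneg κ hκ k) (by positivity))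
        refine Finset.sum_le_sum_of_subset_of_nonneg
          (Finset.range_subset_range.2 (Nat.sub_le _ _)) fun j _ _ => by positivity
      · intro k _ _
        refine mul_nonneg (mul_nonneg (bs_nonneg κ hκ k) (by positivity)) ?_
        exact Finset.sum_nonneg fun j _ => by positivity
    have := Real.exp_pos (-h x)
    nlinarith
  have := anti (Set.left_mem_Icc.2 zero_le_one) (Set.right_mem_Icc.2 zero_le_one) zero_le_one
  have B0 : B 0 = 1 := by
    simp [hB, Finset.sum_range_succ', bs]
  have h0 : h 0 = 0 := by simp [hh]
  have h1 : h 1 ≤ κ := by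
    have := hasSum_tele.mul_left κ
    rw [mul_one] at this
    have := sum_le_hasSum (Finset.range n) (fun i _ => by positivity) this
    simpa [hh, div_eq_mul_inv] using this
  have B1 : B 1 = ∑ k ∈ Finset.range (n+1), bs κ k := by simp [hB]
  simp only [B0, h0, neg_zero, Real.exp_zero, mul_one] at this
  rw [Real.exp_neg, mul_inv_le_iff₀ (Real.exp_pos _), one_mul, B1] at this
  exact this.trans (Real.exp_le_exp.2 h1)

lemma bs_summable (κ : ℝ) (hκ : 0 < κ) : Summable (bs κ) := by
  refine summable_of_sum_range_le (c := Real.exp κ) (bs_nonneg κ hκ) fun n => ?_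
  refine le_trans ?_ (bs_partial κ hκ n)
  exact Finset.sum_le_sum_of_subset_of_nonneg (Finset.range_subset_range.2 (Nat.le_succ n))
    fun k _ _ => bs_nonneg κ hκ k

noncomputable def hs (κ : ℝ) : ℕ → ℝ
  | 0 => 0
  | n+1 => κ / (((n:ℝ)+1) * ((n:ℝ)+2))

lemma hs_hasSum (κ : ℝ) : HasSum (hs κ) κ := by
  rw [← hasSum_nat_add_iff' 1]
  simpa [hs, div_eq_mul_inv] using hasSum_tele.mul_left κ

lemma hs_nonneg (κ : ℝ) (hκ : 0 < κ) (n : ℕ) : 0 ≤ hs κ n := by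
  cases n with
  | zero => simp [hs]
  | succ n => simp only [hs]; positivity

lemma cont_series (f : ℕ → ℝ) (hf0 : ∀ n, 0 ≤ f n) (hf : Summable f) :
    ContinuousOn (fun x : ℝ => ∑' n, f n * x ^ n) (Set.Icc 0 1) := by
  refine continuousOn_tsum (fun n => by fun_prop) hf fun n x hx => ?_
  rw [norm_mul, norm_pow, Real.norm_eq_abs, Real.norm_eq_abs, abs_of_nonneg (hf0 n),
    abs_of_nonneg hx.1]
  exact mul_le_of_le_one_right (hf0 n) (pow_le_one₀ hx.1 hx.2)

lemma bs_tsum (κ : ℝ) (hκ : 0 < κ) : ∑' k, bs κ k = Real.exp κ := by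
  have hb := bs_summable κ hκ
  have hh := (hs_hasSum κ).summable
  set B : ℝ → ℝ := fun x => ∑' n, bs κ n * x ^ n with hB
  set h : ℝ → ℝ := fun x => ∑' n, hs κ n * x ^ n with hhd
  have dB : ∀ x, 0 ≤ x → x < 1 → HasDerivAt B (∑' n : ℕ, ((n:ℝ)+1) * bs κ (n+1) * x ^ n) x := by
    refine hasDerivAt_series _ (∑' k, bs κ k) fun n => ?_
    rw [abs_of_nonneg (bs_nonneg κ hκ n)]
    exact hb.le_tsum n fun k _ => bs_nonneg κ hκ k
  have dh : ∀ x, 0 ≤ x → x < 1 → HasDerivAt h (∑' n : ℕ, ((n:ℝ)+1) * hs κ (n+1) * x ^ n) x := by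
    refine hasDerivAt_series _ (∑' k, hs κ k) fun n => ?_
    rw [abs_of_nonneg (hs_nonneg κ hκ n)]
    exact hh.le_tsum n fun k _ => hs_nonneg κ hκ k
  have key : ∀ x : ℝ, 0 ≤ x → x < 1 → (∑' n : ℕ, ((n:ℝ)+1) * bs κ (n+1) * x ^ n) =
      B x * (∑' n : ℕ, ((n:ℝ)+1) * hs κ (n+1) * x ^ n) := by
    intro x hx hx1
    have g := summable_geometric_of_lt_one hx hx1
    simp only [hB]
    rw [tsum_mul_tsum_eq_tsum_sum_antidiagonal_of_summable_norm]
    · refine tsum_congr fun n => ?_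
      rw [bs_succ, Finset.Nat.sum_antidiagonal_eq_sum_range_succ
        (fun k j => bs κ k * x ^ k * (((j:ℝ)+1) * hs κ (j+1) * x ^ j)), Finset.sum_mul]
      refine Finset.sum_congr rfl fun k hk => ?_
      have : x ^ n = x ^ k * x ^ (n-k) := by
        rw [← pow_add]; congr 1; have := Finset.mem_range.1 hk; omega
      rw [this, hs]
      field_simp
    · refine Summable.of_nonneg_of_le (fun _ => norm_nonneg _) (fun n => ?_) hb
      rw [norm_mul, norm_pow, Real.norm_eq_abs, Real.norm_eq_abs, abs_of_nonneg (bs_nonneg κ hκ n),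
        abs_of_nonneg hx]
      exact mul_le_of_le_one_right (bs_nonneg κ hκ n) (pow_le_one₀ hx hx1.le)
    · refine Summable.of_nonneg_of_le (fun _ => norm_nonneg _) (fun n => ?_) (g.mul_left κ)
      rw [norm_mul, norm_pow, Real.norm_eq_abs, Real.norm_eq_abs, abs_of_nonneg hx, hs]
      have e : ((n:ℝ)+1) * (κ / (((n:ℝ)+1) * ((n:ℝ)+2))) = κ / ((n:ℝ)+2) := by field_simp
      rw [e, abs_of_nonneg (by positivity)]
      gcongr
      exact div_le_self hκ.le (by linarith [(Nat.cast_nonneg n : (0:ℝ) ≤ n)])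
  have const := constant_of_has_deriv_right_zero (f := fun x => B x * Real.exp (-h x)) (a := 0) (b := 1)
    ((cont_series _ (bs_nonneg κ hκ) hb).mul (cont_series _ (hs_nonneg κ hκ) hh).neg.rexp)
    (fun x hx => by
      have := ((dB x hx.1 hx.2).mul (dh x hx.1 hx.2).neg.exp).hasDerivWithinAt (s := Set.Ici x)
      refine this.congr_deriv ?_
      rw [key x hx.1 hx.2]; ring) 1 (Set.right_mem_Icc.2 zero_le_one)
  have B0 : B 0 = 1 := by
    simp only [hB]
    rw [tsum_eq_single 0 (fun n hn => by simp [hn])]; simp [bs]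
  have h0 : h 0 = 0 := by
    simp only [hhd]
    rw [tsum_eq_single 0 (fun n hn => by simp [hn])]; simp [hs]
  have B1 : B 1 = ∑' k, bs κ k := by simp [hB]
  have h1 : h 1 = κ := by simp [hhd, (hs_hasSum κ).tsum_eq]
  simp only [B0, h0, B1, h1, neg_zero, Real.exp_zero, mul_one] at const
  rw [Real.exp_neg, mul_inv_eq_one₀ (Real.exp_pos _).ne'] at const
  exact const

open PowerSeries in
lemma ps_uniq (g F G : PowerSeries ℝ) (hF : derivative ℝ F = g * F) (hG : derivative ℝ G = g * G)
    (h0 : coeff 0 F = coeff 0 G) : F = G := by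
  ext n
  induction n using Nat.strong_induction_on with
  | _ n ih =>
    cases n with
    | zero => exact h0
    | succ n =>
      have h1 := congrArg (coeff n) hF
      have h2 := congrArg (coeff n) hG
      rw [coeff_derivative, coeff_mul] at h1 h2
      have : ∑ p ∈ Finset.HasAntidiagonal.antidiagonal n, coeff p.1 g * coeff p.2 F =
          ∑ p ∈ Finset.HasAntidiagonal.antidiagonal n, coeff p.1 g * coeff p.2 G := by
        refine Finset.sum_congr rfl fun p hp => ?_
        rw [ih p.2 (by have := Finset.HasAntidiagonal.mem_antidiagonal.1 hp; omega)]
      rw [← h1, ← h2] at this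
      exact mul_right_cancel₀ (by positivity) this

noncomputable def cs (μ : ℝ) (n : ℕ) : ℝ := ∏ j ∈ Finset.range n, ((j:ℝ)+1+μ)/((j:ℝ)+1)

lemma cs_succ (μ : ℝ) (n : ℕ) : cs μ (n+1) * ((n:ℝ)+1) = cs μ n * ((n:ℝ)+1+μ) := by
  rw [cs, Finset.prod_range_succ, ← cs]; field_simp

lemma cs_pos (μ : ℝ) (hμ : 0 < μ) (n : ℕ) : 0 < cs μ n :=
  Finset.prod_pos fun j _ => by positivity

lemma cs_mono (μ : ℝ) (hμ : 0 < μ) : Monotone (cs μ) := by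
  refine monotone_nat_of_le_succ fun n => ?_
  have h := cs_succ μ n
  have := cs_pos μ hμ n
  have h3 : (0:ℝ) < (n:ℝ)+1 := by positivity
  by_contra hlt
  push Not at hlt
  nlinarith

lemma cs_ratio (μ : ℝ) (hμ : 0 < μ) : Tendsto (fun n => cs μ n / cs μ (n+1)) atTop (𝓝 1) := by
  have e : ∀ n : ℕ, cs μ n / cs μ (n+1) = 1 / (1 + μ * (1 / ((n:ℝ)+1))) := by
    intro n
    have h := cs_succ μ n
    have h1 := cs_pos μ hμ (n+1)
    have h2 : 0 < (n:ℝ)+1+μ := by positivity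
    field_simp
    linarith
  simp only [e]
  have := ((tendsto_one_div_add_atTop_nhds_zero_nat (𝕜 := ℝ)).const_mul μ).const_add 1
  simpa using this.inv₀ (by simp)

lemma cs_asymp (μ : ℝ) (hμ : 0 < μ) :
    Tendsto (fun n : ℕ => cs μ n / (n:ℝ) ^ μ) atTop (𝓝 (1 / (μ * Real.Gamma μ))) := by
  have h := (Real.GammaSeq_tendsto_Gamma μ).const_mul μ
  have h2 := h.inv₀ (mul_pos hμ (Real.Gamma_pos_of_pos hμ)).ne'
  rw [one_div]
  refine h2.congr fun n => ?_
  have e : ∏ j ∈ Finset.range (n+1), (μ + (j:ℝ)) = μ * (n.factorial * cs μ n) := by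
    rw [Finset.prod_range_succ']
    have : ∏ k ∈ Finset.range n, (μ + ((k+1:ℕ):ℝ)) = n.factorial * cs μ n := by
      rw [cs, Finset.prod_div_distrib, ← Finset.prod_range_add_one_eq_factorial]
      push_cast
      rw [mul_div_cancel₀]
      · exact Finset.prod_congr rfl fun _ _ => by ring
      · exact (Finset.prod_pos fun j _ => by positivity).ne'
    rw [this]; push_cast; ring
  rw [Real.GammaSeq, e]
  have := cs_pos μ hμ n
  have : (n.factorial : ℝ) ≠ 0 := by positivity
  field_simp

noncomputable def ds (κ μ : ℝ) (n : ℕ) : ℝ := ∑ k ∈ Finset.range (n+1), bs κ k * cs μ (n-k)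

lemma ds_pos (κ μ : ℝ) (hκ : 0 < κ) (hμ : 0 < μ) (n : ℕ) : 0 < ds κ μ n := by
  refine Finset.sum_pos' (fun k _ => mul_nonneg (bs_nonneg κ hκ k) (cs_pos μ hμ _).le) ⟨0, by simp, ?_⟩
  simpa [bs] using cs_pos μ hμ n

lemma ds_mono (κ μ : ℝ) (hκ : 0 < κ) (hμ : 0 < μ) : Monotone (ds κ μ) := by
  refine monotone_nat_of_le_succ fun n => ?_
  rw [ds, ds, Finset.sum_range_succ _ (n+1)]
  have h1 := mul_nonneg (bs_nonneg κ hκ (n+1)) (cs_pos μ hμ (n+1-(n+1))).le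
  have h2 : ∑ k ∈ Finset.range (n+1), bs κ k * cs μ (n-k) ≤
      ∑ k ∈ Finset.range (n+1), bs κ k * cs μ (n+1-k) :=
    Finset.sum_le_sum fun k _ => mul_le_mul_of_nonneg_left (cs_mono μ hμ (by omega)) (bs_nonneg κ hκ k)
  linarith

lemma ds_div (κ μ : ℝ) (hκ : 0 < κ) (hμ : 0 < μ) :
    Tendsto (fun n => ds κ μ n / cs μ n) atTop (𝓝 (Real.exp κ)) := by
  rw [← bs_tsum κ hκ]
  exact tannery (bs κ) (cs μ) (bs_summable κ hκ).abs (cs_pos μ hμ) (cs_mono μ hμ) (cs_ratio μ hμ)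

lemma ds_ratio (κ μ : ℝ) (hκ : 0 < κ) (hμ : 0 < μ) :
    Tendsto (fun n => ds κ μ n / ds κ μ (n+1)) atTop (𝓝 1) := by
  have h := ds_div κ μ hκ hμ
  have h1 := (h.mul (cs_ratio μ hμ)).div (h.comp (tendsto_add_atTop_nat 1)) (Real.exp_pos κ).ne'
  rw [mul_one, div_self (Real.exp_pos κ).ne'] at h1
  refine h1.congr fun n => ?_
  have := (cs_pos μ hμ n).ne'
  have := (cs_pos μ hμ (n+1)).ne'
  have := (ds_pos κ μ hκ hμ (n+1)).ne'
  simp only [Function.comp, Pi.div_apply]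
  field_simp

noncomputable def es (κ μ : ℝ) : ℕ → ℝ
  | 0 => κ / 2 + μ
  | n+1 => κ / ((n:ℝ)+3) - κ / ((n:ℝ)+2)

lemma es_hasSum (κ μ : ℝ) : HasSum (es κ μ) μ := by
  rw [← hasSum_nat_add_iff' 1]
  have h := (((hasSum_nat_add_iff' 1).2 hasSum_tele)).mul_left (-κ)
  have e1 : (fun n => es κ μ (n+1)) =
      fun i : ℕ => -κ * (1 / ((((i+1:ℕ):ℝ) + 1) * (((i+1:ℕ):ℝ) + 2))) := by
    funext n; simp only [es]; push_cast; field_simp; ring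
  have e2 : μ - ∑ i ∈ Finset.range 1, es κ μ i =
      -κ * (1 - ∑ i ∈ Finset.range 1, 1 / (((i:ℝ) + 1) * ((i:ℝ) + 2))) := by
    simp [es]; ring
  rw [e1, e2]
  exact h

lemma es_asymp (κ μ : ℝ) (hκ : 0 < κ) (hμ : 0 < μ) :
    Tendsto (fun n => (∑ k ∈ Finset.range (n+1), es κ μ k * ds κ μ (n-k)) / ds κ μ n)
      atTop (𝓝 μ) := by
  have := tannery (es κ μ) (ds κ μ) (es_hasSum κ μ).summable.abs (ds_pos κ μ hκ hμ)
    (ds_mono κ μ hκ hμ) (ds_ratio κ μ hκ hμ)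
  rwa [(es_hasSum κ μ).tsum_eq] at this

open PowerSeries in
lemma a_formula (κ μ : ℝ) (a : ℕ → ℝ)
    (ha : ∀ n : ℕ, ((n:ℝ)+1) * a (n+1) =
      ∑ k ∈ Finset.range (n+1), (μ + κ / (((n-k:ℕ):ℝ)+2)) * a k) (n : ℕ) :
    ((n:ℝ)+1) * a (n+1) = a 0 * ∑ k ∈ Finset.range (n+1), es κ μ k * ds κ μ (n-k) := by
  set A : PowerSeries ℝ := PowerSeries.mk a with hA
  set B : PowerSeries ℝ := PowerSeries.mk (bs κ) with hB
  set Z : PowerSeries ℝ := PowerSeries.mk (cs μ) with hZ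
  set v : PowerSeries ℝ := PowerSeries.mk (fun m => κ / ((m:ℝ)+2)) with hv
  set I : PowerSeries ℝ := PowerSeries.mk 1 with hI
  have hI1 : I * (1 - X) = 1 := PowerSeries.mk_one_mul_one_sub_eq_one ℝ
  have dA : derivative ℝ A = (v + PowerSeries.C μ * I) * A := by
    ext m
    rw [coeff_derivative, mul_comm _ A, coeff_mul, Finset.Nat.sum_antidiagonal_eq_sum_range_succ
      (fun i j => coeff i A * coeff j (v + PowerSeries.C μ * I))]
    simp only [hA, hv, hI, coeff_mk, map_add, coeff_C_mul, Pi.one_apply]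
    rw [mul_comm, ha]
    exact Finset.sum_congr rfl fun k _ => by ring
  have dB : derivative ℝ B = v * B := by
    ext m
    rw [coeff_derivative, mul_comm _ B, coeff_mul, Finset.Nat.sum_antidiagonal_eq_sum_range_succ
      (fun i j => coeff i B * coeff j v)]
    simp only [hB, hv, coeff_mk]
    rw [mul_comm, bs_succ]
    exact Finset.sum_congr rfl fun k _ => by ring
  have dZ : derivative ℝ Z * (1 - X) = PowerSeries.C (μ + 1) * Z := by
    ext m
    rw [mul_sub, mul_one, map_sub, coeff_C_mul]
    cases m with
    | zero =>
      have := cs_succ μ 0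
      simp [coeff_derivative, hZ] at this ⊢
      linarith
    | succ m =>
      have := cs_succ μ (m+1)
      rw [coeff_succ_mul_X, coeff_derivative, coeff_derivative]
      simp only [hZ, coeff_mk]
      push_cast at this ⊢
      linarith
  have dX : derivative ℝ (1 - X : PowerSeries ℝ) = -1 := by
    rw [map_sub, derivative_X]; simp
  have hC : (PowerSeries.C (μ+1) : PowerSeries ℝ) = PowerSeries.C μ + 1 := by simp
  rw [hC] at dZ
  set δ : PowerSeries ℝ := v * (1 - X) + PowerSeries.C μ with hδ
  have dD : derivative ℝ (PowerSeries.C (a 0) * ((1 - X) * (B * Z))) =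
      PowerSeries.C (a 0) * (δ * (B * Z)) := by
    simp only [Derivation.leibniz, smul_eq_mul, derivative_C, dX, dB]
    rw [hδ]
    linear_combination (PowerSeries.C (a 0) * B) * dZ
  have eqA : A = PowerSeries.C (a 0) * ((1 - X) * (B * Z)) := by
    refine ps_uniq _ _ _ dA ?_ ?_
    · rw [dD, hδ]
      linear_combination (-PowerSeries.C (a 0) * PowerSeries.C μ * B * Z) * hI1
    · simp [hA, hB, hZ, bs, cs]
  have h1 := congrArg (coeff n) (congrArg (derivative ℝ) eqA)
  rw [dD, coeff_derivative, coeff_C_mul, coeff_mul, Finset.Nat.sum_antidiagonal_eq_sum_range_succ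
      (fun i j => coeff i δ * coeff j (B * Z)), hA, coeff_mk, mul_comm] at h1
  rw [h1]
  congr 1
  refine Finset.sum_congr rfl fun k _ => ?_
  congr 1
  · rw [hδ, mul_sub, mul_one, map_add, map_sub]
    cases k with
    | zero => simp [hv, es]
    | succ k =>
      rw [coeff_succ_mul_X]
      simp only [hv, coeff_mk, es, coeff_C]
      push_cast
      simp
      ring
  · rw [coeff_mul, Finset.Nat.sum_antidiagonal_eq_sum_range_succ
      (fun i j => coeff i B * coeff j Z)]
    simp [hB, hZ, ds]

/-- Tail with exponential cut-off for the Lea–Coulson (neutral, pure-birth) mutant number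
at finite wild-type size `N`: `p_n ∼ (1−1/N)^n · n^{μ−1}/Γ(μ)`. -/
theorem lea_coulson_tail_exponential_cutoff
    (N θ : ℝ) (hN : 1 < N) (hθ : 0 < θ)
    (φ μ : ℝ) (hφ : φ = 1 - 1 / N) (hμ : μ = θ / N)
    (Q P : ℕ → ℝ)
    (hQ0 : Q 0 = -θ * φ)
    (hQ : ∀ k : ℕ, 1 ≤ k → Q k = θ * (φ ^ k / (k : ℝ) - φ ^ (k + 1) / ((k : ℝ) + 1)))
    (hP0 : P 0 = Real.exp (Q 0))
    (hP : ∀ n : ℕ, 1 ≤ n →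
      P n = (1 / (n : ℝ)) * ∑ k ∈ Finset.range n, ((n : ℝ) - k) * Q (n - k) * P k) :
    Tendsto
      (fun n : ℕ => P n * Real.Gamma μ * (n : ℝ) ^ (1 - μ) * φ ^ (-(n : ℤ)))
      atTop (nhds 1) := by
  have hN0 : 0 < N := by linarith
  have hφ0 : 0 < φ := by
    rw [hφ, sub_pos, div_lt_one hN0]; exact hN
  have hμ0 : 0 < μ := by rw [hμ]; positivity
  have hμ1 : μ = θ * (1 - φ) := by rw [hμ, hφ]; ring
  set κ := θ * φ with hκ
  have hκ0 : 0 < κ := by positivity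
  set a : ℕ → ℝ := fun n => P n / φ ^ n with ha
  have ha0 : a 0 = Real.exp (-κ) := by
    simp [ha, hP0, hQ0, hκ]
  have hrec : ∀ n : ℕ, ((n:ℝ)+1) * a (n+1) =
      ∑ k ∈ Finset.range (n+1), (μ + κ / (((n-k:ℕ):ℝ)+2)) * a k := by
    intro n
    simp only [ha]
    rw [hP (n+1) (by omega)]
    push_cast
    have hn : ((n:ℝ)+1) ≠ 0 := by positivity
    rw [← mul_div_assoc, ← mul_assoc, mul_one_div_cancel hn, one_mul, Finset.sum_div]
    refine Finset.sum_congr rfl fun k hk => ?_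
    obtain ⟨m, rfl⟩ : ∃ m, n = k + m := ⟨n - k, by have := Finset.mem_range.1 hk; omega⟩
    have e : k + m + 1 - k = m + 1 := by omega
    rw [e, hQ (m+1) (by omega), Nat.add_sub_cancel_left, hμ1, hκ]
    push_cast
    have h1 : ((m:ℝ)+1) ≠ 0 := by positivity
    have h2 : ((m:ℝ)+2) ≠ 0 := by positivity
    have h3 : ((m:ℝ)+1+1) ≠ 0 := by positivity
    have e2 : φ ^ (k+m+1) = φ ^ k * φ ^ m * φ := by ring
    have e3 : φ ^ (m+1+1) = φ ^ m * φ * φ := by ring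
    have e4 : φ ^ (m+1) = φ ^ m * φ := by ring
    rw [e2, e3, e4]
    field_simp
    ring
  have hform := a_formula κ μ a hrec
  rw [← tendsto_add_atTop_iff_nat 1]
  have t1 := es_asymp κ μ hκ0 hμ0
  have t2 := ds_div κ μ hκ0 hμ0
  have t3 := cs_ratio μ hμ0
  have t4 := (cs_asymp μ hμ0).comp (tendsto_add_atTop_nat 1)
  have T := ((((t1.mul t2).mul t3).mul t4).mul_const (Real.Gamma μ)).const_mul (a 0)
  have hΓ := Real.Gamma_pos_of_pos hμ0
  have lim : a 0 * (μ * Real.exp κ * 1 * (1 / (μ * Real.Gamma μ)) * Real.Gamma μ) = 1 := by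
    rw [ha0, Real.exp_neg]
    have := Real.exp_pos κ
    field_simp
  rw [lim] at T
  refine T.congr fun n => ?_
  have c1 := (cs_pos μ hμ0 n).ne'
  have c2 := (cs_pos μ hμ0 (n+1)).ne'
  have c3 := (ds_pos κ μ hκ0 hμ0 n).ne'
  have hn : (0:ℝ) < (n:ℝ)+1 := by positivity
  have c4 := (Real.rpow_pos_of_pos hn μ).ne'
  have hf := hform n
  have hPa : P (n+1) = a (n+1) * φ ^ (n+1) := by
    simp only [ha]; field_simp
  rw [hPa, zpow_neg, zpow_natCast]
  simp only [Function.comp]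
  push_cast
  rw [Real.rpow_sub hn, Real.rpow_one]
  set S := ∑ k ∈ Finset.range (n+1), es κ μ k * ds κ μ (n-k)
  have hφn : φ ^ (n+1) ≠ 0 := by positivity
  calc _ = (a 0 * S) * Real.Gamma μ / ((n:ℝ)+1) ^ μ := by field_simp
    _ = _ := by rw [← hf]; field_simp
end
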